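/- Let R and B be two disjoint finite sets of points in the plane with |B| ≤ |R| and R ∪ B in general position, and let δ = ⌈(|R|−1)/|B|⌉. Then there exists a plane bichromatic tree on R ∪ B whose maximum vertex degree is at most max{3, δ + 1}. -/

import Mathlib

open scoped Classical

noncomputable section

/-- The plane. -/
abbrev Pt : Type := ℝ × ℝ

/-- A set of points is in general position if no three of its points are collinear. -/
def GenPos (P : Set Pt) : Prop :=
  ∀ p ∈ P, ∀ q ∈ P, ∀ r ∈ P, p ≠ q → p ≠ r → q ≠ r →
    ¬ Collinear ℝ ({p, q, r} : Set Pt)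

/-- Degree of a vertex in a simple graph. -/
def deg {V : Type*} (G : SimpleGraph V) (v : V) : ℕ := (G.neighborSet v).ncard

/-- `G` is a plane bichromatic spanning tree on `R ∪ B`: a spanning tree of the
geometric complete bipartite graph `K(R,B)` (every edge joins a point of `R` and a
point of `B`), drawn with straight-line segments, no two of which cross (any point
lying on two distinct closed edges is a common endpoint of both). -/
def PlaneBichromTree (R B : Finset Pt) (G : SimpleGraph {x : Pt // x ∈ R ∪ B}) : Prop :=
  G.IsTree ∧
  (∀ u v : {x : Pt // x ∈ R ∪ B}, G.Adj u v →
      ((u.1 ∈ R ∧ v.1 ∈ B) ∨ (u.1 ∈ B ∧ v.1 ∈ R))) ∧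
  (∀ u v x y : {x : Pt // x ∈ R ∪ B}, G.Adj u v → G.Adj x y →
      s(u, v) ≠ s(x, y) →
      ∀ p : Pt, p ∈ segment ℝ u.1 v.1 → p ∈ segment ℝ x.1 y.1 →
        (p = u.1 ∨ p = v.1) ∧ (p = x.1 ∨ p = y.1))


/-- Orientation determinant. -/
def cr (p q r : Pt) : ℝ := (q.1-p.1)*(r.2-p.2)-(q.2-p.2)*(r.1-p.1)

/-- Signed orientation determinant. -/
def D (e : ℝ) (p q r : Pt) : ℝ := e * cr p q r

/-- Affine functional vanishing at `g`. -/
def F (α β : ℝ) (g t : Pt) : ℝ := α*(t.1-g.1)+β*(t.2-g.2)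

/-- General position for lists. -/
def GP (l : List Pt) : Prop :=
  ∀ p ∈ l, ∀ q ∈ l, ∀ r ∈ l, p ≠ q → p ≠ r → q ≠ r → cr p q r ≠ 0

/-- indicator -/
def ind (a b : Pt) : ℕ := if b = a then 1 else 0

lemma cnt_cons (a b : Pt) (l : List Pt) : (b :: l).count a = ind a b + l.count a := by
  simp only [List.count_cons, ind, beq_iff_eq]; omega

/-- sub-multiset -/
def SubL (m l : List Pt) : Prop := ∀ a, m.count a ≤ l.count a

lemma SubL.mem {m l : List Pt} (h : SubL m l) {a : Pt} (ha : a ∈ m) : a ∈ l := by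
  have := h a
  have h2 := List.count_pos_iff.2 ha
  exact List.count_pos_iff.1 (by omega)

/-- Good lists: no duplicates and general position. -/
def Good (l : List Pt) : Prop := l.Nodup ∧ GP l

lemma Good.sub {m l : List Pt} (hl : Good l) (h : SubL m l) : Good m := by
  refine ⟨?_, ?_⟩
  · rw [List.nodup_iff_count_le_one]
    intro a
    exact (h a).trans (List.nodup_iff_count_le_one.1 hl.1 a)
  · intro p hp q hq r hr
    exact hl.2 p (h.mem hp) q (h.mem hq) r (h.mem hr)

/-- Non crossing of two edges. -/
def NC (e f : Pt × Pt) : Prop :=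
  ∀ p, p ∈ segment ℝ e.1 e.2 → p ∈ segment ℝ f.1 f.2 → (p = e.1 ∨ p = e.2) ∧ (p = f.1 ∨ p = f.2)

lemma NC.symm {e f : Pt × Pt} (h : NC e f) : NC f e := fun p hp hq => (h p hq hp).symm

/-- adjacency -/
def Aj (E : Finset (Pt × Pt)) (x y : Pt) : Prop := (x,y) ∈ E ∨ (y,x) ∈ E

/-- Plane tree on a list. -/
structure PTree (red : Pt → Prop) (l : List Pt) (E : Finset (Pt × Pt)) : Prop where
  mem : ∀ e ∈ E, e.1 ∈ l ∧ e.2 ∈ l ∧ red e.1 ∧ ¬ red e.2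
  conn : ∀ u ∈ l, ∀ v ∈ l, Relation.ReflTransGen (Aj E) u v
  card : E.card + 1 = l.length
  nc : ∀ e ∈ E, ∀ f ∈ E, e ≠ f → NC e f

/-- degree in edge set -/
def dg (E : Finset (Pt × Pt)) (v : Pt) : ℕ := (E.filter (fun e => e.1 = v ∨ e.2 = v)).card

/-- tree with caps -/
def Tr (red : Pt → Prop) (l : List Pt) (c : Pt → ℕ) : Prop :=
  ∃ E, PTree red l E ∧ ∀ v ∈ l, dg E v ≤ c v

/-- tree with a designated point -/
def TrAt (red : Pt → Prop) (g : Pt) (m : ℕ) (l : List Pt) (c : Pt → ℕ) : Prop :=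
  ∃ E, PTree red (g :: l) E ∧ dg E g ≤ m ∧ ∀ v ∈ l, dg E v ≤ c v

variable {red : Pt → Prop} {c c' : Pt → ℕ} {g x : Pt} {m m1 m2 : ℕ} {l P Q : List Pt}

lemma PTree.perm {l' : List Pt} {E} (h : PTree red l E) (p : l.Perm l') : PTree red l' E := by
  refine ⟨fun e he => ?_, fun u hu v hv => ?_, ?_, h.nc⟩
  · have := h.mem e he
    rwa [p.mem_iff, p.mem_iff] at this
  · exact h.conn u (p.mem_iff.2 hu) v (p.mem_iff.2 hv)
  · rw [h.card, p.length_eq]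

lemma perm_of_cnt {l l' : List Pt} (h : ∀ a, l.count a = l'.count a) : l.Perm l' :=
  List.perm_iff_count.2 h

lemma Tr.at {l' : List Pt} (h : Tr red l c) (p : ∀ a, l.count a = (g :: l').count a)
    (hc : c g ≤ m) (hc' : ∀ t ∈ l', c t ≤ c' t) : TrAt red g m l' c' := by
  obtain ⟨E, hE, hd⟩ := h
  have p := perm_of_cnt p
  refine ⟨E, hE.perm p, (hd g (p.mem_iff.2 (by simp))).trans hc, fun v hv => ?_⟩
  exact (hd v (p.mem_iff.2 (by simp [hv]))).trans (hc' v hv)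

lemma TrAt.tr (h : TrAt red g m l c) (hm : m ≤ c' g) (hc' : ∀ t ∈ l, c t ≤ c' t) :
    Tr red (g :: l) c' := by
  obtain ⟨E, hE, hd, hd'⟩ := h
  refine ⟨E, hE, fun v hv => ?_⟩
  rcases List.mem_cons.1 hv with rfl | hv
  · omega
  · exact (hd' v hv).trans (hc' v hv)

lemma TrAt.mono (h : TrAt red g m1 l c) (hm : m1 ≤ m2) (hc' : ∀ t ∈ l, c t ≤ c' t) :
    TrAt red g m2 l c' := by
  obtain ⟨E, hE, hd, hd'⟩ := h
  exact ⟨E, hE, hd.trans hm, fun v hv => (hd' v hv).trans (hc' v hv)⟩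

lemma TrAt.perm {l' : List Pt} (h : TrAt red g m l c) (p : ∀ a, l.count a = l'.count a) :
    TrAt red g m l' c := by
  obtain ⟨E, hE, hd, hd'⟩ := h
  have p := perm_of_cnt p
  exact ⟨E, hE.perm (p.cons g), hd, fun v hv => hd' v (p.mem_iff.2 hv)⟩

/-- change the designated point -/
lemma TrAt.swap {l' : List Pt} {h : Pt} (H : TrAt red g m l c) (hm : m ≤ c' g)
    (p : ∀ a, (g :: l).count a = (h :: l').count a) (hh : h ∈ l)
    (hc : c h ≤ m1) (hc' : ∀ t ∈ l', t ≠ g → c t ≤ c' t) : TrAt red h m1 l' c' := by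
  obtain ⟨E, hE, hd, hd'⟩ := H
  have p := perm_of_cnt p
  refine ⟨E, hE.perm p, (hd' h hh).trans hc, fun v hv => ?_⟩
  have : v ∈ g :: l := p.mem_iff.2 (by simp [hv])
  by_cases hvg : v = g
  · subst hvg; omega
  · rcases List.mem_cons.1 this with h | hv'
    · exact absurd h hvg
    · exact (hd' v hv').trans (hc' v hv hvg)

lemma dg_union (E1 E2 : Finset (Pt × Pt)) (v : Pt) : dg (E1 ∪ E2) v ≤ dg E1 v + dg E2 v := by
  unfold dg
  rw [Finset.filter_union]
  exact Finset.card_union_le _ _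

lemma dg_zero {E} (h : PTree red l E) (v : Pt) (hv : v ∉ l) : dg E v = 0 := by
  unfold dg
  rw [Finset.card_eq_zero, Finset.filter_eq_empty_iff]
  rintro e he (rfl | rfl)
  · exact hv (h.mem e he).1
  · exact hv (h.mem e he).2.1

lemma PTree.union {E1 E2} (h1 : PTree red (g :: P) E1) (h2 : PTree red (g :: Q) E2)
    (hn : (g :: (P ++ Q)).Nodup) (hx : ∀ e ∈ E1, ∀ f ∈ E2, NC e f) :
    PTree red (g :: (P ++ Q)) (E1 ∪ E2) := by
  have hdis : Disjoint E1 E2 := by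
    rw [Finset.disjoint_left]
    intro e he1 he2
    have a1 := h1.mem e he1
    have a2 := h2.mem e he2
    have key : ∀ v, v ∈ g :: P → v ∈ g :: Q → v = g := by
      intro v hv1 hv2
      simp only [List.nodup_cons, List.nodup_append, List.mem_append] at hn
      rcases List.mem_cons.1 hv1 with r | hv1
      · exact r
      · rcases List.mem_cons.1 hv2 with r | hv2
        · exact r
        · exact absurd rfl (hn.2.2.2 v hv1 v hv2)
    have e1 := key _ a1.1 a2.1
    have e2 := key _ a1.2.1 a2.2.1
    rw [e1] at a1; rw [e2] at a1
    exact a1.2.2.2 a1.2.2.1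
  refine ⟨?_, ?_, ?_, ?_⟩
  · intro e he
    rcases Finset.mem_union.1 he with he | he
    · obtain ⟨a, b, cc⟩ := h1.mem e he
      refine ⟨?_, ?_, cc⟩ <;> simp only [List.mem_cons, List.mem_append] at * <;> tauto
    · obtain ⟨a, b, cc⟩ := h2.mem e he
      refine ⟨?_, ?_, cc⟩ <;> simp only [List.mem_cons, List.mem_append] at * <;> tauto
  · have mono1 : ∀ u v, Relation.ReflTransGen (Aj E1) u v → Relation.ReflTransGen (Aj (E1 ∪ E2)) u v := by
      intro u v h
      refine Relation.ReflTransGen.mono ?_ _ _ h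
      intro a b hab
      simp only [Aj, Finset.mem_union, id] at *; tauto
    have mono2 : ∀ u v, Relation.ReflTransGen (Aj E2) u v → Relation.ReflTransGen (Aj (E1 ∪ E2)) u v := by
      intro u v h
      refine Relation.ReflTransGen.mono ?_ _ _ h
      intro a b hab
      simp only [Aj, Finset.mem_union, id] at *; tauto
    have tog : ∀ u ∈ g :: (P ++ Q), Relation.ReflTransGen (Aj (E1 ∪ E2)) u g ∧
        Relation.ReflTransGen (Aj (E1 ∪ E2)) g u := by
      intro u hu
      have : u ∈ g :: P ∨ u ∈ g :: Q := by
        simp only [List.mem_cons, List.mem_append] at *; tauto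
      rcases this with h | h
      · exact ⟨mono1 _ _ (h1.conn u h g (by simp)), mono1 _ _ (h1.conn g (by simp) u h)⟩
      · exact ⟨mono2 _ _ (h2.conn u h g (by simp)), mono2 _ _ (h2.conn g (by simp) u h)⟩
    intro u hu v hv
    exact (tog u hu).1.trans (tog v hv).2
  · rw [Finset.card_union_of_disjoint hdis]
    have := h1.card; have := h2.card
    simp only [List.length_cons, List.length_append] at *; omega
  · intro e he f hf hne
    rcases Finset.mem_union.1 he with he | he <;> rcases Finset.mem_union.1 hf with hf | hf
    · exact h1.nc e he f hf hne
    · exact hx e he f hf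
    · exact (hx f hf e he).symm
    · exact h2.nc e he f hf hne

lemma dg_caps {E1 E2} (h1 : PTree red (g :: P) E1) (h2 : PTree red (g :: Q) E2)
    (hn : (g :: (P ++ Q)).Nodup) (d1 : dg E1 g ≤ m1) (d2 : dg E2 g ≤ m2)
    (c1 : ∀ v ∈ P, dg E1 v ≤ c v) (c2 : ∀ v ∈ Q, dg E2 v ≤ c v) :
    dg (E1 ∪ E2) g ≤ m1 + m2 ∧ ∀ v ∈ P ++ Q, dg (E1 ∪ E2) v ≤ c v := by
  simp only [List.nodup_cons, List.nodup_append, List.mem_append] at hn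
  refine ⟨(dg_union _ _ _).trans (by omega), fun v hv => (dg_union _ _ _).trans ?_⟩
  rcases List.mem_append.1 hv with hv | hv
  · rw [dg_zero h2 v]
    · simpa using c1 v hv
    · rintro h
      rcases List.mem_cons.1 h with rfl | h
      · exact hn.1 (Or.inl hv)
      · exact hn.2.2.2 v hv v h rfl
  · rw [dg_zero h1 v]
    · simpa using c2 v hv
    · rintro h
      rcases List.mem_cons.1 h with rfl | h
      · exact hn.1 (Or.inr hv)
      · exact hn.2.2.2 v h v hv rfl

lemma cr_of_seg {a b p : Pt} (h : p ∈ segment ℝ a b) : cr a b p = 0 := by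
  obtain ⟨s, t, hs, ht, hst, rfl⟩ := h
  have : s = 1 - t := by linarith
  subst this
  simp [cr]; ring

lemma seg_end {α β : ℝ} {g a b p : Pt} (h : p ∈ segment ℝ a b) (ha : 0 ≤ F α β g a)
    (hb : 0 ≤ F α β g b) (hab : 0 < F α β g a ∨ 0 < F α β g b) (hp : F α β g p ≤ 0) :
    (p = a ∧ F α β g a = 0) ∨ (p = b ∧ F α β g b = 0) := by
  obtain ⟨s, t, hs, ht, hst, rfl⟩ := h
  have e : F α β g (s • a + t • b) = s * F α β g a + t * F α β g b := by
    have : s = 1 - t := by linarith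
    subst this
    simp [F]; ring
  rw [e] at hp
  have h1 := mul_nonneg hs ha
  have h2 := mul_nonneg ht hb
  have z1 : s * F α β g a = 0 := by linarith
  have z2 : t * F α β g b = 0 := by linarith
  rcases mul_eq_zero.1 z1 with r | r
  · right
    have : t = 1 := by linarith
    subst this; subst r
    simp at z2 ⊢; exact z2
  · left
    rcases mul_eq_zero.1 z2 with r' | r'
    · have : s = 1 := by linarith
      subst this; subst r'
      simp [r]
    · rcases hab with h | h <;> linarith

lemma seg_nonpos {α β : ℝ} {g a b p : Pt} (h : p ∈ segment ℝ a b) (ha : F α β g a ≤ 0)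
    (hb : F α β g b ≤ 0) : F α β g p ≤ 0 := by
  obtain ⟨s, t, hs, ht, hst, rfl⟩ := h
  have e : F α β g (s • a + t • b) = s * F α β g a + t * F α β g b := by
    have : s = 1 - t := by linarith
    subst this
    simp [F]; ring
  rw [e]
  have h1 := mul_nonneg hs (neg_nonneg.2 ha)
  have h2 := mul_nonneg ht (neg_nonneg.2 hb)
  linarith

lemma nc_sep {α β : ℝ} {e f : Pt × Pt} (hgp : GP (g :: (P ++ Q)))
    (he1 : e.1 ∈ g :: P) (he2 : e.2 ∈ g :: P) (hne : e.1 ≠ e.2)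
    (hf1 : f.1 ∈ g :: Q) (hf2 : f.2 ∈ g :: Q) (hnf : f.1 ≠ f.2)
    (hP : ∀ t ∈ P, F α β g t ≤ 0) (hQ : ∀ t ∈ Q, 0 < F α β g t) : NC e f := by
  intro p hp hq
  have g0 : F α β g g = 0 := by simp [F]
  have hP' : ∀ t ∈ g :: P, F α β g t ≤ 0 := by
    intro t ht; rcases List.mem_cons.1 ht with rfl | ht
    · exact g0.le
    · exact hP t ht
  have hQ' : ∀ t ∈ g :: Q, 0 ≤ F α β g t ∧ (F α β g t = 0 → t = g) := by
    intro t ht; rcases List.mem_cons.1 ht with rfl | ht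
    · exact ⟨g0.ge, fun _ => rfl⟩
    · exact ⟨(hQ t ht).le, fun h => absurd h (hQ t ht).ne'⟩
  have hp0 := seg_nonpos hp (hP' _ he1) (hP' _ he2)
  have hpos : 0 < F α β g f.1 ∨ 0 < F α β g f.2 := by
    by_contra! h
    exact hnf (((hQ' _ hf1).2 (le_antisymm h.1 (hQ' _ hf1).1)).trans
      ((hQ' _ hf2).2 (le_antisymm h.2 (hQ' _ hf2).1)).symm)
  have hend := seg_end hq (hQ' _ hf1).1 (hQ' _ hf2).1 hpos hp0
  have hpg : p = g := by
    rcases hend with ⟨a, b⟩ | ⟨a, b⟩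
    · rw [a]; exact (hQ' _ hf1).2 b
    · rw [a]; exact (hQ' _ hf2).2 b
  refine ⟨?_, by tauto⟩
  by_contra! h
  have := hgp e.1 (by simp only [List.mem_cons, List.mem_append] at *; tauto)
    e.2 (by simp only [List.mem_cons, List.mem_append] at *; tauto) g (by simp) hne
    (hpg ▸ h.1.symm) (hpg ▸ h.2.symm)
  exact this (hpg ▸ cr_of_seg hp)

lemma PTree.ne {E} (h : PTree red l E) {e} (he : e ∈ E) : e.1 ≠ e.2 := by
  have := h.mem e he
  intro h; rw [h] at this; tauto

lemma glue (α β : ℝ) (h1 : TrAt red g m1 P c) (h2 : TrAt red g m2 Q c) (hG : Good (g :: (P ++ Q)))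
    (hP : ∀ t ∈ P, F α β g t ≤ 0) (hQ : ∀ t ∈ Q, 0 < F α β g t) :
    TrAt red g (m1 + m2) (P ++ Q) c := by
  obtain ⟨E1, t1, d1, c1⟩ := h1
  obtain ⟨E2, t2, d2, c2⟩ := h2
  refine ⟨E1 ∪ E2, t1.union t2 hG.1 ?_, dg_caps t1 t2 hG.1 d1 d2 c1 c2⟩
  intro e he f hf
  exact nc_sep hG.2 (t1.mem e he).1 (t1.mem e he).2.1 (t1.ne he) (t2.mem f hf).1
    (t2.mem f hf).2.1 (t2.ne hf) hP hQ

lemma two (hx : ¬ (red g ↔ red x)) : ∃ E, PTree red [g, x] E ∧ dg E g ≤ 1 ∧ dg E x ≤ 1 ∧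
    ∀ e ∈ E, e = (g, x) ∨ e = (x, g) := by
  have key : ∀ a b : Pt, red a → ¬ red b → PTree red [a, b] {(a,b)} := by
    intro a b ha hb
    refine ⟨?_, ?_, by simp, ?_⟩
    · intro e he
      rw [Finset.mem_singleton] at he; subst he; simp [ha, hb]
    · intro u hu v hv
      have s1 : Relation.ReflTransGen (Aj {(a,b)}) a b := .single (by simp [Aj])
      have s2 : Relation.ReflTransGen (Aj {(a,b)}) b a := .single (by simp [Aj])
      simp at hu hv
      rcases hu with rfl | rfl <;> rcases hv with rfl | rfl
      · exact .refl
      · exact s1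
      · exact s2
      · exact .refl
    · intro e he f hf hne
      rw [Finset.mem_singleton] at he hf; rw [he, hf] at hne; exact absurd rfl hne
  have dk : ∀ a b v : Pt, dg {(a,b)} v ≤ 1 := by
    intro a b v
    exact (Finset.card_filter_le _ _).trans (by simp)
  by_cases h : red g
  · exact ⟨{(g,x)}, key _ _ h (by tauto), dk _ _ _, dk _ _ _, by simp⟩
  · exact ⟨{(x,g)}, (key x g (by tauto) h).perm (List.Perm.swap _ _ _), dk _ _ _, dk _ _ _, by simp⟩

lemma TrAt_two (hx : ¬ (red g ↔ red x)) (hc : 1 ≤ c x) : TrAt red g 1 [x] c := by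
  obtain ⟨E, h1, h2, h3, -⟩ := two hx
  exact ⟨E, h1, h2, by simpa using h3.trans hc⟩

/-- leaf on the open side -/
lemma leaf_pos (α β : ℝ) (h1 : TrAt red g m P c) (hx : ¬ (red g ↔ red x)) (hc : 1 ≤ c x)
    (hG : Good (g :: x :: P)) (hP : ∀ t ∈ P, F α β g t ≤ 0) (hQ : 0 < F α β g x) :
    TrAt red g (m + 1) (x :: P) c := by
  refine (glue α β h1 (TrAt_two hx hc) (hG.sub ?_) hP (by simpa using hQ)).perm ?_
  all_goals intro a; simp only [cnt_cons, List.count_append, List.count_nil]; omega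

/-- leaf on the closed side -/
lemma leaf_neg (α β : ℝ) (h1 : TrAt red g m P c) (hx : ¬ (red g ↔ red x)) (hc : 1 ≤ c x)
    (hG : Good (g :: x :: P)) (hP : ∀ t ∈ P, 0 < F α β g t) (hQ : F α β g x ≤ 0) :
    TrAt red g (m + 1) (x :: P) c := by
  have := (glue α β (TrAt_two hx hc) h1 (hG.sub ?_) (by simpa using hQ) hP).perm (l' := x :: P) ?_
  · rwa [add_comm]
  all_goals intro a; simp only [cnt_cons, List.count_append, List.count_nil]; omega

/-- two leaves, each separated by a line of its own -/
lemma twoLeaf (α β α' β' : ℝ) {y : Pt} (h1 : TrAt red g m P c) (hx : ¬ (red g ↔ red x))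
    (hc : 1 ≤ c x) (hy : ¬ (red g ↔ red y)) (hcy : 1 ≤ c y)
    (hG : Good (g :: x :: y :: P)) (hP : ∀ t ∈ P, F α β g t ≤ 0) (hQ : 0 < F α β g x)
    (hP' : ∀ t ∈ P, F α' β' g t ≤ 0) (hQ' : 0 < F α' β' g y) :
    TrAt red g (m + 2) (x :: y :: P) c := by
  obtain ⟨E1, t1, d1, c1⟩ := h1
  obtain ⟨Ex, tx, dx, cx, ex⟩ := two hx
  obtain ⟨Ey, ty, dy, cy, ey⟩ := two hy
  have n1 : (g :: ([x] ++ P)).Nodup := (hG.sub (by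
    intro a; simp only [cnt_cons, List.count_append, List.count_nil]; omega)).1
  have G1 : Good (g :: (P ++ [x])) := (hG.sub (by
    intro a; simp only [cnt_cons, List.count_append, List.count_nil]; omega))
  have G1' : Good (g :: (P ++ [y])) := (hG.sub (by
    intro a; simp only [cnt_cons, List.count_append, List.count_nil]; omega))
  have n2 : (g :: ([y] ++ ([x] ++ P))).Nodup := (hG.sub (by
    intro a; simp only [cnt_cons, List.count_append, List.count_nil]; omega)).1
  have u1 := tx.union t1 n1 (by
    intro e he f hf
    exact (nc_sep G1.2 (t1.mem f hf).1 (t1.mem f hf).2.1 (t1.ne hf) (tx.mem e he).1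
      (tx.mem e he).2.1 (tx.ne he) hP (by simpa using hQ)).symm)
  have k1 := dg_caps (c := c) tx t1 n1 dx d1 (by simpa using cx.trans hc) c1
  have u2 := ty.union u1 n2 (by
    intro e he f hf
    rcases Finset.mem_union.1 hf with hf | hf
    · -- the two edges at g
      have gp := hG.2 g (by simp) x (by simp) y (by simp)
      have hn := hG.1
      simp only [List.nodup_cons, List.mem_cons] at hn
      push Not at hn
      have gp := gp hn.1.1 hn.1.2.1 hn.2.1.1
      intro p hp hq
      have hp' : p ∈ segment ℝ g y := by
        rcases ey e he with r | r <;> rw [r] at hp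
        · exact hp
        · rw [segment_symm]; exact hp
      have hq' : p ∈ segment ℝ g x := by
        rcases ex f hf with r | r <;> rw [r] at hq
        · exact hq
        · rw [segment_symm]; exact hq
      have pg : p = g := by
        have a2 := cr_of_seg hq'
        obtain ⟨s, t, hs, ht, hst, rfl⟩ := hp'
        have e1 : s = 1 - t := by linarith
        subst e1
        have : t * cr g x y = 0 := by
          rw [← a2]; simp [cr]; ring
        rcases mul_eq_zero.1 this with r | r
        · subst r; simp
        · exact absurd r gp
      subst pg
      rcases ey e he with r | r <;> rcases ex f hf with r' | r' <;> simp [r, r']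
    · exact (nc_sep G1'.2 (t1.mem f hf).1 (t1.mem f hf).2.1 (t1.ne hf) (ty.mem e he).1
        (ty.mem e he).2.1 (ty.ne he) hP' (by simpa using hQ')).symm)
  have k2 := dg_caps (c := c) ty u1 n2 dy k1.1 (by simpa using cy.trans hcy) k1.2
  have : TrAt red g (1 + (1 + m)) ([y] ++ ([x] ++ P)) c := ⟨_, u2, k2⟩
  refine (this.mono (by omega) (fun _ _ => le_rfl)).perm ?_
  intro a; simp only [cnt_cons, List.count_append, List.count_nil]; omega
/-- extreme point -/
def Exm (l : List Pt) (v : Pt) : Prop := ∃ α β, ∀ t ∈ l, t ≠ v → 0 < F α β v t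

/-- `b` sees `x` beyond `T` -/
def Sees (T : List Pt) (b x : Pt) : Prop :=
  ∃ α β, (∀ t ∈ T, t ≠ x → 0 < F α β x t) ∧ F α β x b ≤ 0

/-- sorted around `x` -/
def Srt (e : ℝ) (x : Pt) (l : List Pt) : Prop := l.Pairwise (fun s t => 0 < D e x s t)

lemma Exm.mono {l l' : List Pt} {v : Pt} (h : Exm l v) (hs : ∀ t ∈ l', t ∈ l) : Exm l' v := by
  obtain ⟨α, β, h⟩ := h
  exact ⟨α, β, fun t ht => h t (hs t ht)⟩

lemma D_swap (e : ℝ) (p q r : Pt) : D e p q r = - D e p r q := by simp only [D, cr]; ring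
lemma D_cyc (e : ℝ) (p q r : Pt) : D e p q r = D e q r p := by simp only [D, cr]; ring
lemma D_swap' (e : ℝ) (p q r : Pt) : D e p q r = - D e q p r := by simp only [D, cr]; ring
lemma D_neg (e : ℝ) (p q r : Pt) : D (-e) p q r = - D e p q r := by simp only [D, cr]; ring
lemma D_neg' (e : ℝ) (p q r : Pt) : D (-e) p q r = D e p r q := by simp only [D, cr]; ring
lemma D_F (e : ℝ) (g y t : Pt) : F (-e*(y.2-g.2)) (e*(y.1-g.1)) g t = D e g y t := by
  simp only [D, cr, F]; ring
lemma D_F' (e : ℝ) (g y t : Pt) : F (e*(y.2-g.2)) (-e*(y.1-g.1)) g t = - D e g y t := by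
  simp only [D, cr, F]; ring
lemma D_self (e : ℝ) (g y : Pt) : D e g y y = 0 := by simp only [D, cr]; ring
lemma D_self' (e : ℝ) (g y : Pt) : D e g y g = 0 := by simp only [D, cr]; ring

lemma GP.D {l : List Pt} (h : GP l) {e : ℝ} (he : e ≠ 0) {p q r : Pt} (hp : p ∈ l) (hq : q ∈ l)
    (hr : r ∈ l) (h1 : p ≠ q) (h2 : p ≠ r) (h3 : q ≠ r) : D e p q r ≠ 0 :=
  mul_ne_zero he (h p hp q hq r hr h1 h2 h3)

lemma GP.lt_or {l : List Pt} (h : GP l) {e : ℝ} (he : e ≠ 0) {p q r : Pt} (hp : p ∈ l) (hq : q ∈ l)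
    (hr : r ∈ l) (h1 : p ≠ q) (h2 : p ≠ r) (h3 : q ≠ r) :
    0 < _root_.D e p q r ∨ 0 < _root_.D e p r q := by
  have := h.D he hp hq hr h1 h2 h3
  rw [D_swap e p r q]
  rcases lt_or_gt_of_ne this with h | h
  · right; linarith
  · left; exact h

lemma perturb (f g : Pt → ℝ) (l : List Pt) (h : ∀ t ∈ l, 0 < f t) :
    ∃ η : ℝ, 0 < η ∧ ∀ t ∈ l, 0 < f t + η * g t := by
  suffices ∃ η : ℝ, 0 < η ∧ ∀ t ∈ l, ∀ η', 0 < η' → η' ≤ η → 0 < f t + η' * g t by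
    obtain ⟨η, h1, h2⟩ := this
    exact ⟨η, h1, fun t ht => h2 t ht η h1 le_rfl⟩
  induction l with
  | nil => exact ⟨1, one_pos, by simp⟩
  | cons a l ih =>
    obtain ⟨η, h1, h2⟩ := ih (fun t ht => h t (by simp [ht]))
    have ha := h a (by simp)
    have hp : 0 < |g a| + 1 := by positivity
    refine ⟨min η (f a / (|g a| + 1)), lt_min h1 (by positivity), ?_⟩
    intro t ht η' h3 h4
    rcases List.mem_cons.1 ht with rfl | ht
    · have h5 := h4.trans (min_le_right _ _)
      rw [le_div_iff₀ hp] at h5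
      have h6 : η' * -(g t) ≤ η' * |g t| := mul_le_mul_of_nonneg_left (neg_le_abs _) h3.le
      linarith
    · exact h2 t ht η' h3 (h4.trans (min_le_left _ _))

lemma F_add (α β α' β' η : ℝ) (p t : Pt) :
    F (α + η * α') (β + η * β') p t = F α β p t + η * F α' β' p t := by
  simp only [F]; ring

lemma ne_sq {p q : Pt} (h : q ≠ p) : 0 < F (q.1-p.1) (q.2-p.2) p q := by
  unfold F
  by_contra! h'
  apply h
  have h1 : q.1 - p.1 = 0 := by nlinarith [sq_nonneg (q.1-p.1), sq_nonneg (q.2-p.2)]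
  have h2 : q.2 - p.2 = 0 := by nlinarith [sq_nonneg (q.1-p.1), sq_nonneg (q.2-p.2)]
  exact Prod.ext (by linarith) (by linarith)

lemma ext_tangent {α β : ℝ} {p q : Pt} {l : List Pt}
    (h : ∀ t ∈ l, t ≠ p → t ≠ q → 0 < F α β p t) (hq : 0 ≤ F α β p q) (hne : q ≠ p) : Exm l p := by
  obtain ⟨η, h1, h2⟩ := perturb (F α β p) (F (q.1-p.1) (q.2-p.2) p)
    (l.filter (fun t => t ≠ p ∧ t ≠ q)) (by
      intro t ht
      simp only [List.mem_filter, decide_eq_true_eq] at ht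
      exact h t ht.1 ht.2.1 ht.2.2)
  refine ⟨α + η * (q.1-p.1), β + η * (q.2-p.2), fun t ht htp => ?_⟩
  rw [F_add]
  by_cases htq : t = q
  · subst htq
    have := mul_pos h1 (ne_sq hne)
    linarith
  · exact h2 t (by simp [ht, htp, htq])

lemma ext_side {e : ℝ} {p q : Pt} {l : List Pt}
    (h : ∀ t ∈ l, t ≠ p → t ≠ q → 0 < D e p q t) (hne : q ≠ p) : Exm l p := by
  refine ext_tangent (α := -e*(q.2-p.2)) (β := e*(q.1-p.1)) (q := q) ?_ ?_ hne
  · intro t ht h1 h2; rw [D_F]; exact h t ht h1 h2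
  · rw [D_F, D_self]

lemma sees_side {e : ℝ} {b x : Pt} {l : List Pt}
    (h : ∀ t ∈ l, t ≠ x → 0 < D e b x t) : Sees l b x := by
  refine ⟨e*(b.2-x.2), -e*(b.1-x.1), fun t ht h1 => ?_, ?_⟩
  · rw [D_F']; have := h t ht h1; rw [D_swap'] at this; exact this
  · rw [D_F', D_self, neg_zero]

/-- `b` beyond the line `x z` sees `z`. -/
lemma sees_beyond {e : ℝ} {b x z : Pt} {l : List Pt}
    (h : ∀ t ∈ l, t ≠ z → 0 < D e x z t) (hb : D e x z b ≤ 0) : Sees l b z := by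
  refine ⟨e*(x.2-z.2), -e*(x.1-z.1), fun t ht h1 => ?_, ?_⟩
  · rw [D_F']; have := h t ht h1; rw [D_swap'] at this; exact this
  · rw [D_F']; rw [D_swap'] at hb; exact hb

lemma Srt.rev {e : ℝ} {x : Pt} {l : List Pt} (h : Srt e x l) : Srt (-e) x l.reverse := by
  unfold Srt at *
  rw [List.pairwise_reverse]
  refine h.imp ?_
  intro a b hab
  rw [D_neg']; exact hab

lemma plucker (α β e : ℝ) (x a b d : Pt) :
    F α β x a * D e x b d - F α β x b * D e x a d + F α β x d * D e x a b = 0 := by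
  simp only [F, D, cr]; ring

lemma ins {e : ℝ} {x a : Pt} {l : List Pt} (hE : Exm (a :: l) x) (ha : a ≠ x) (hx : x ∉ l)
    (hs : Srt e x l) (hn : ∀ t ∈ l, D e x t a ≠ 0) :
    ∃ m1 m2, l = m1 ++ m2 ∧ Srt e x (m1 ++ a :: m2) := by
  obtain ⟨α, β, hE⟩ := hE
  have ha' := hE a (by simp) ha
  have hl : ∀ t ∈ l, 0 < F α β x t := fun t ht => hE t (by simp [ht]) (by rintro rfl; exact hx ht)
  clear hE hx
  suffices ∃ m1 m2, l = m1 ++ m2 ∧ (∀ t ∈ m1, 0 < D e x t a) ∧ (∀ t ∈ m2, 0 < D e x a t) by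
    obtain ⟨m1, m2, h1, h2, h3⟩ := this
    subst h1
    refine ⟨m1, m2, rfl, ?_⟩
    unfold Srt at *
    rw [List.pairwise_append] at hs ⊢
    refine ⟨hs.1, List.pairwise_cons.2 ⟨h3, hs.2.1⟩, ?_⟩
    intro s hs' t ht
    rcases List.mem_cons.1 ht with rfl | ht
    · exact h2 s hs'
    · exact hs.2.2 s hs' t ht
  induction l with
  | nil => exact ⟨[], [], rfl, by simp, by simp⟩
  | cons h l ih =>
    have hs2 := List.pairwise_cons.1 hs
    rcases lt_or_gt_of_ne (hn h (by simp)) with hh | hh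
    · refine ⟨[], h :: l, rfl, by simp, ?_⟩
      rw [D_swap] at hh
      intro t ht
      rcases List.mem_cons.1 ht with rfl | ht'
      · linarith
      · have p1 := plucker α β e x a h t
        have p2 := hs2.1 t ht'
        have q1 := hl h (by simp)
        have q2 := hl t ht
        by_contra! hc
        have : 0 < F α β x a * D e x h t := mul_pos ha' p2
        have : 0 < F α β x t * D e x a h := mul_pos q2 (by linarith)
        have : F α β x h * D e x a t ≤ 0 := mul_nonpos_of_nonneg_of_nonpos q1.le hc
        linarith
    · obtain ⟨m1, m2, h1, h2, h3⟩ := ih hs2.2 (fun t ht => hn t (by simp [ht]))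
        (fun t ht => hl t (by simp [ht]))
      refine ⟨h :: m1, m2, by simp [h1], ?_, h3⟩
      intro t ht
      rcases List.mem_cons.1 ht with rfl | ht
      · exact hh
      · exact h2 t ht

lemma sort_ex {e : ℝ} (he : e ≠ 0) {x : Pt} {l : List Pt} (hE : Exm l x) (hG : Good (x :: l)) :
    ∃ l', l.Perm l' ∧ Srt e x l' := by
  induction l with
  | nil => exact ⟨[], List.Perm.refl _, List.Pairwise.nil⟩
  | cons a l ih =>
    obtain ⟨l', h1, h2⟩ := ih (hE.mono (by simp +contextual)) (hG.sub (by
      intro a; simp only [cnt_cons]; omega))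
    have hn := hG.1
    simp only [List.nodup_cons, List.mem_cons] at hn
    push Not at hn
    obtain ⟨m1, m2, h3, h4⟩ := ins (a := a) (l := l') (hE.mono (by
        intro t ht
        simpa [h1.mem_iff] using ht)) hn.1.1.symm (by rw [← h1.mem_iff]; exact hn.1.2) h2 (by
        intro t ht
        have ht' := h1.mem_iff.2 ht
        refine hG.2.D he (by simp) (by simp [ht']) (by simp) ?_ hn.1.1 ?_
        · rintro rfl; exact hn.1.2 ht'
        · rintro rfl; exact hn.2.1 ht')
    refine ⟨m1 ++ a :: m2, ?_, h4⟩
    subst h3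
    exact (h1.cons a).trans List.perm_middle.symm

lemma F_sub (α β : ℝ) (o p q : Pt) : F α β o q - F α β o p = F α β p q := by
  simp only [F]; ring

lemma no_three {α β : ℝ} {o p q t : Pt} (hp : 0 < F α β o p) (h1 : F α β o q = F α β o p)
    (h2 : F α β o t = F α β o p) : cr p q t = 0 := by
  have a1 : F α β p q = 0 := by rw [← F_sub α β o]; linarith
  have a2 : F α β p t = 0 := by rw [← F_sub α β o]; linarith
  by_contra hc
  have b1 : α * cr p q t = 0 := by
    have : α * cr p q t = F α β p q * (t.2 - p.2) - F α β p t * (q.2 - p.2) := by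
      simp only [F, cr]; ring
    rw [this, a1, a2]; ring
  have b2 : β * cr p q t = 0 := by
    have : β * cr p q t = F α β p t * (q.1 - p.1) - F α β p q * (t.1 - p.1) := by
      simp only [F, cr]; ring
    rw [this, a1, a2]; ring
  have c1 : α = 0 := by simpa [hc] using b1
  have c2 : β = 0 := by simpa [hc] using b2
  subst c1; subst c2
  simp [F] at hp

lemma ivt {o v1 q1 : Pt} {U : List Pt} {α0 β0 α1 β1 : ℝ} (hG : GP U)
    (hv : v1 ∈ U) (hvb : ¬ red v1) (h0 : F α0 β0 o v1 = 0)
    (h0' : ∀ t ∈ U, t ≠ v1 → 0 < F α0 β0 o t)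
    (hq : q1 ∈ U) (hqr : red q1) (h1 : 0 ≤ F α1 β1 o q1)
    (h1' : ∀ t ∈ U, t ≠ q1 → F α1 β1 o q1 < F α1 β1 o t) :
    ∃ α β p q, p ∈ U ∧ ¬ red p ∧ q ∈ U ∧ red q ∧ 0 < F α β o p ∧ F α β o q = F α β o p ∧
      ∀ t ∈ U, t ≠ p → t ≠ q → F α β o p < F α β o t := by
  let Bs := U.toFinset.filter (fun t => ¬ red t)
  let Rs := U.toFinset.filter (fun t => red t)
  have hB : Bs.Nonempty := ⟨v1, by simp [Bs, hv, hvb]⟩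
  have hR : Rs.Nonempty := ⟨q1, by simp [Rs, hq, hqr]⟩
  have mB : ∀ t, t ∈ Bs ↔ t ∈ U ∧ ¬ red t := by simp [Bs]
  have mR : ∀ t, t ∈ Rs ↔ t ∈ U ∧ red t := by simp [Rs]
  let f : Pt → ℝ → ℝ := fun t s => (1 - s) * F α0 β0 o t + s * F α1 β1 o t
  let h : ℝ → ℝ := fun s => Bs.inf' hB (fun t => f t s) - Rs.inf' hR (fun t => f t s)
  have hc : Continuous h := by
    apply Continuous.sub
    · apply Continuous.finset_inf'_apply
      intro i _; fun_prop
    · apply Continuous.finset_inf'_apply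
      intro i _; fun_prop
  have hne : v1 ≠ q1 := by rintro rfl; exact hvb hqr
  have hh0 : h 0 < 0 := by
    have a1 : Bs.inf' hB (fun t => f t 0) ≤ f v1 0 := Finset.inf'_le (fun t => f t 0) ((mB _).2 ⟨hv, hvb⟩)
    have a2 : 0 < Rs.inf' hR (fun t => f t 0) := by
      rw [Finset.lt_inf'_iff]
      intro t ht
      have := h0' t ((mR t).1 ht).1 (by rintro rfl; exact hvb ((mR _).1 ht).2)
      simpa [f] using this
    have a3 : f v1 0 = 0 := by simp [f, h0]
    simp only [h]; linarith
  have hh1 : 0 < h 1 := by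
    have a1 : Rs.inf' hR (fun t => f t 1) ≤ f q1 1 := Finset.inf'_le (fun t => f t 1) ((mR _).2 ⟨hq, hqr⟩)
    have a2 : f q1 1 < Bs.inf' hB (fun t => f t 1) := by
      rw [Finset.lt_inf'_iff]
      intro t ht
      have := h1' t ((mB t).1 ht).1 (by rintro rfl; exact ((mB _).1 ht).2 hqr)
      simpa [f] using this
    simp only [h]; linarith
  obtain ⟨s, hs, hs0⟩ := intermediate_value_Icc (zero_le_one' ℝ) hc.continuousOn
    (show (0:ℝ) ∈ Set.Icc (h 0) (h 1) from ⟨hh0.le, hh1.le⟩)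
  have s0 : 0 < s := lt_of_le_of_ne hs.1 (by rintro rfl; linarith)
  have s1 : s < 1 := lt_of_le_of_ne hs.2 (by rintro rfl; linarith)
  have hf : ∀ t, F ((1-s)*α0 + s * α1) ((1-s)*β0 + s*β1) o t = f t s := by
    intro t; simp only [F, f]; ring
  have hpos : ∀ t ∈ U, 0 < f t s := by
    intro t ht
    have n1 : 0 ≤ F α1 β1 o t := by
      by_cases htq : t = q1
      · rw [htq]; exact h1
      · exact h1.trans (h1' t ht htq).le
    by_cases htv : t = v1
    · have := h1' t ht (htv ▸ hne)
      have : 0 < s * F α1 β1 o t := mul_pos s0 (by linarith)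
      have e : F α0 β0 o t = 0 := by rw [htv]; exact h0
      simp only [f, e]; linarith
    · have := mul_pos (sub_pos.2 s1) (h0' t ht htv)
      have := mul_nonneg s0.le n1
      simp only [f]; linarith
  obtain ⟨p, hp, hp'⟩ := Finset.exists_mem_eq_inf' hB (fun t => f t s)
  obtain ⟨q, hq, hq'⟩ := Finset.exists_mem_eq_inf' hR (fun t => f t s)
  have hpq : f q s = f p s := by
    have : h s = f p s - f q s := by simp only [h]; rw [hp', hq']
    linarith
  have hmin : ∀ t ∈ U, f p s ≤ f t s := by
    intro t ht
    by_cases hr : red t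
    · rw [← hpq, ← hq']; exact Finset.inf'_le (fun t => f t s) ((mR t).2 ⟨ht, hr⟩)
    · rw [← hp']; exact Finset.inf'_le (fun t => f t s) ((mB t).2 ⟨ht, hr⟩)
  rw [mB] at hp; rw [mR] at hq
  refine ⟨(1-s)*α0 + s * α1, (1-s)*β0 + s*β1, p, q, hp.1, hp.2, hq.1, hq.2, ?_, ?_, ?_⟩
  · rw [hf]; exact hpos p hp.1
  · rw [hf, hf, hpq]
  · intro t ht h1 h2
    rw [hf, hf]
    refine lt_of_le_of_ne (hmin t ht) ?_
    intro heq
    refine hG p hp.1 q hq.1 t ht ?_ h1.symm h2.symm ?_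
    · rintro rfl; exact hp.2 hq.2
    · refine no_three (o := o) (α := (1-s)*α0 + s * α1) (β := (1-s)*β0 + s*β1) ?_ ?_ ?_
      · rw [hf]; exact hpos p hp.1
      · rw [hf, hf, hpq]
      · rw [hf, hf, heq]

/-- weight -/
def wt (red : Pt → Prop) (k : Pt → ℕ) (t : Pt) : ℤ := if red t then 1 else 1 - (k t : ℤ)

/-- total weight -/
def tot (red : Pt → Prop) (k : Pt → ℕ) (l : List Pt) : ℤ := (l.map (wt red k)).sum

variable {k : Pt → ℕ}

lemma tot_nil : tot red k [] = 0 := rfl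
lemma tot_cons (a : Pt) (l : List Pt) : tot red k (a :: l) = wt red k a + tot red k l := by
  simp [tot]
lemma tot_append (l m : List Pt) : tot red k (l ++ m) = tot red k l + tot red k m := by
  simp [tot]
lemma tot_perm {l m : List Pt} (h : l.Perm m) : tot red k l = tot red k m := by
  exact (h.map _).sum_eq
lemma tot_rev (l : List Pt) : tot red k l.reverse = tot red k l := tot_perm l.reverse_perm
lemma wt_red {t : Pt} (h : red t) : wt red k t = 1 := by simp [wt, h]
lemma wt_blue {t : Pt} (h : ¬ red t) : wt red k t = 1 - k t := by simp [wt, h]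
lemma tot_congr {k' : Pt → ℕ} {l : List Pt} (h : ∀ t ∈ l, k t = k' t) : tot red k l = tot red k' l := by
  unfold tot
  congr 1
  apply List.map_congr_left
  intro t ht
  simp [wt, h t ht]

lemma first_one {l : List Pt} (s : ℤ) (hk : ∀ t ∈ l, ¬ red t → 1 ≤ k t) (hs : s ≤ 0)
    (h : 0 < s + tot red k l) :
    ∃ L r N, l = L ++ r :: N ∧ red r ∧ s + tot red k L = 0 := by
  induction l generalizing s with
  | nil => rw [tot_nil] at h; omega
  | cons a l ih =>
    rw [tot_cons] at h
    by_cases ha : red a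
    · rw [wt_red ha] at h
      by_cases h0 : s = 0
      · exact ⟨[], a, l, rfl, ha, by rw [tot_nil]; omega⟩
      · obtain ⟨L, r, N, h1, h2, h3⟩ := ih (s + 1) (fun t ht => hk t (by simp [ht])) (by omega) (by omega)
        exact ⟨a :: L, r, N, by simp [h1], h2, by rw [tot_cons, wt_red ha]; omega⟩
    · have := hk a (by simp) ha
      rw [wt_blue ha] at h
      obtain ⟨L, r, N, h1, h2, h3⟩ := ih (s + (1 - k a)) (fun t ht => hk t (by simp [ht])) (by omega) (by omega)
      exact ⟨a :: L, r, N, by simp [h1], h2, by rw [tot_cons, wt_blue ha]; omega⟩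

lemma first_neg {l : List Pt} (s : ℤ) (hs : 0 ≤ s) (h : s + tot red k l < 0) :
    ∃ L z N, l = L ++ z :: N ∧ ¬ red z ∧ 0 ≤ s + tot red k L ∧ s + tot red k L + (1 - k z) < 0 ∧
      (L = [] ∨ ∃ L' y, L = L' ++ [y] ∧ 0 ≤ s + tot red k L') := by
  induction l generalizing s with
  | nil => rw [tot_nil] at h; omega
  | cons a l ih =>
    rw [tot_cons] at h
    by_cases h0 : s + wt red k a < 0
    · have ha : ¬ red a := by intro ha; rw [wt_red ha] at h0; omega
      rw [wt_blue ha] at h0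
      exact ⟨[], a, l, rfl, ha, by rw [tot_nil]; omega, by rw [tot_nil]; omega, Or.inl rfl⟩
    · obtain ⟨L, z, N, h1, h2, h3, h4, h5⟩ := ih (s + wt red k a) (by omega) (by omega)
      refine ⟨a :: L, z, N, by simp [h1], h2, by rw [tot_cons]; omega, by rw [tot_cons]; omega, Or.inr ?_⟩
      rcases h5 with rfl | ⟨L', y, rfl, h5⟩
      · exact ⟨[], a, rfl, by rw [tot_nil]; omega⟩
      · exact ⟨a :: L', y, rfl, by rw [tot_cons]; omega⟩
set_option linter.unusedSimpArgs false

set_option linter.unusedSimpArgs false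
/-- degree caps -/
def K (red : Pt → Prop) (k : Pt → ℕ) (v : Pt) : ℕ := if red v then 3 else k v

lemma K_red {t : Pt} (h : red t) : K red k t = 3 := by simp [K, h]
lemma K_blue {t : Pt} (h : ¬ red t) : K red k t = k t := by simp [K, h]
lemma K_congr {k' : Pt → ℕ} {t : Pt} (h : k t = k' t) : K red k t = K red k' t := by simp [K, h]

/-- all blue caps at least two -/
def B2 (red : Pt → Prop) (k : Pt → ℕ) (l : List Pt) : Prop := ∀ t ∈ l, ¬ red t → 2 ≤ k t

lemma B2.mono {l l' : List Pt} (h : B2 red k l) (hs : ∀ t ∈ l', t ∈ l) : B2 red k l' :=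
  fun t ht => h t (hs t ht)

lemma K_pos {l : List Pt} (h : B2 red k l) {t : Pt} (ht : t ∈ l) : 1 ≤ K red k t := by
  by_cases hr : red t
  · rw [K_red hr]; omega
  · rw [K_blue hr]; have := h t ht hr; omega

lemma TrAt_nil : TrAt red g m [] c := by
  refine ⟨∅, ⟨by simp, ?_, by simp, by simp⟩, by simp [dg], by simp⟩
  intro u hu v hv
  simp at hu hv
  rw [hu, hv]

lemma opp {a b : Pt} (ha : red a) (hb : ¬ red b) : ¬ (red a ↔ red b) := by tauto
lemma opp' {a b : Pt} (ha : red a) (hb : ¬ red b) : ¬ (red b ↔ red a) := by tauto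

lemma glueD (e : ℝ) (y : Pt) (h1 : TrAt red g m1 P c) (h2 : TrAt red g m2 Q c)
    (hG : Good (g :: (P ++ Q)))
    (hP : ∀ t ∈ P, D e g y t ≤ 0) (hQ : ∀ t ∈ Q, 0 < D e g y t) :
    TrAt red g (m1 + m2) (P ++ Q) c :=
  glue (-e*(y.2-g.2)) (e*(y.1-g.1)) h1 h2 hG (fun t ht => by rw [D_F]; exact hP t ht)
    (fun t ht => by rw [D_F]; exact hQ t ht)

lemma leafD_pos (e : ℝ) (y : Pt) (h1 : TrAt red g m P c) (hx : ¬ (red g ↔ red x)) (hc : 1 ≤ c x)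
    (hG : Good (g :: x :: P)) (hP : ∀ t ∈ P, D e g y t ≤ 0) (hQ : 0 < D e g y x) :
    TrAt red g (m + 1) (x :: P) c :=
  leaf_pos (-e*(y.2-g.2)) (e*(y.1-g.1)) h1 hx hc hG (fun t ht => by rw [D_F]; exact hP t ht)
    (by rw [D_F]; exact hQ)

lemma leafD_neg (e : ℝ) (y : Pt) (h1 : TrAt red g m P c) (hx : ¬ (red g ↔ red x)) (hc : 1 ≤ c x)
    (hG : Good (g :: x :: P)) (hP : ∀ t ∈ P, 0 < D e g y t) (hQ : D e g y x ≤ 0) :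
    TrAt red g (m + 1) (x :: P) c :=
  leaf_neg (-e*(y.2-g.2)) (e*(y.1-g.1)) h1 hx hc hG (fun t ht => by rw [D_F]; exact hP t ht)
    (by rw [D_F]; exact hQ)

/-- two trees at `z` separated by the line `v z`, with a leaf `v` at `z` -/
lemma join {e : ℝ} {v z : Pt} {L N : List Pt} (h1 : TrAt red z m1 L c) (h2 : TrAt red z m2 N c)
    (hG : Good (v :: z :: (L ++ N))) (hop : ¬ (red z ↔ red v))
    (hm : m1 + m2 + 1 ≤ c z)
    (hL : ∀ t ∈ L, 0 < D e v t z) (hN : ∀ t ∈ N, 0 < D e v z t) :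
    TrAt red v 1 (z :: (L ++ N)) c := by
  have hn := hG.1
  simp only [List.nodup_cons, List.mem_cons, List.mem_append] at hn
  push Not at hn
  let c' : Pt → ℕ := Function.update c v 1
  have e1 : c' v = 1 := by simp [c']
  have e2 : ∀ t, t ≠ v → c' t = c t := fun t ht => by simp [c', ht]
  have h1' : TrAt red z m1 L c' := h1.mono le_rfl (fun t ht => (e2 t (by rintro rfl; exact hn.1.2.1 ht)).ge)
  have h2' : TrAt red z m2 N c' := h2.mono le_rfl (fun t ht => (e2 t (by rintro rfl; exact hn.1.2.2 ht)).ge)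
  have h3 := leafD_neg (x := v) e v h1' hop e1.ge (hG.sub (by intro _; simp only [cnt_cons, List.count_append, List.count_nil]; omega)) (by
    intro t ht
    have := hL t ht
    rw [D_cyc]; exact this) (by rw [D_self])
  have h4 := glueD (-e) v h3 h2' (hG.sub (by intro _; simp only [cnt_cons, List.count_append, List.count_nil]; omega)) (by
    intro t ht
    rcases List.mem_cons.1 ht with rfl | ht
    · rw [D_self]
    · have := hL t ht
      rw [D_neg, D_cyc]; linarith) (by
    intro t ht
    have := hN t ht
    rw [D_neg, D_swap', neg_neg]; exact this)
  refine h4.swap (h := v) (l' := z :: (L ++ N)) (by omega) (by intro _; simp only [cnt_cons, List.count_append, List.count_nil]; omega) (by simp) e1.le ?_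
  intro t ht _
  refine (e2 t ?_).le
  rintro rfl
  simp only [List.mem_cons, List.mem_append] at ht
  tauto

lemma hang {e : ℝ} {v z : Pt} {N : List Pt} (h2 : TrAt red z m N c)
    (hG : Good (v :: z :: N)) (hop : ¬ (red z ↔ red v))
    (hm : m + 1 ≤ c z) (hN : ∀ t ∈ N, 0 < D e v z t) :
    TrAt red v 1 (z :: N) c :=
  join (m1 := 0) (L := []) TrAt_nil h2 hG hop (by omega) (by simp) hN

/-- leaf `x` on the open side, then re-root at `x` -/
lemma hang_pos {α β : ℝ} {z v : Pt} {N : List Pt} (h : TrAt red z m N c)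
    (hG : Good (v :: z :: N)) (hop : ¬ (red z ↔ red v))
    (hm : m + 1 ≤ c z) (hN : ∀ t ∈ N, F α β z t ≤ 0) (hv : 0 < F α β z v) :
    TrAt red v 1 (z :: N) c := by
  have hn := hG.1
  simp only [List.nodup_cons, List.mem_cons] at hn
  push Not at hn
  let c' : Pt → ℕ := Function.update c v 1
  have e1 : c' v = 1 := by simp [c']
  have e2 : ∀ t, t ≠ v → c' t = c t := fun t ht => by simp [c', ht]
  have h1' : TrAt red z m N c' := h.mono le_rfl (fun t ht => (e2 t (by rintro rfl; exact hn.1.2 ht)).ge)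
  have h3 := leaf_pos (x := v) α β h1' hop e1.ge (hG.sub (by intro _; simp only [cnt_cons, List.count_append, List.count_nil]; omega)) hN hv
  refine h3.swap (h := v) (l' := z :: N) (by omega) (by intro _; simp only [cnt_cons, List.count_append, List.count_nil]; omega) (by simp) e1.le ?_
  intro t ht _
  refine (e2 t ?_).le
  rintro rfl
  simp only [List.mem_cons] at ht
  tauto

lemma srt_mid {e : ℝ} {L N : List Pt} {z : Pt} (h : Srt e x (L ++ z :: N)) :
    (∀ t ∈ L, 0 < D e x t z) ∧ (∀ t ∈ N, 0 < D e x z t) ∧ (∀ s ∈ L, ∀ t ∈ N, 0 < D e x s t) := by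
  unfold Srt at h
  simp only [List.pairwise_append, List.pairwise_cons, List.mem_cons] at h
  refine ⟨fun t ht => h.2.2 t ht z (Or.inl rfl), h.2.1.1, fun s hs t ht => h.2.2 s hs t (Or.inr ht)⟩

/-- induction hypothesis with one special blue point -/
def PQ (red : Pt → Prop) (n : ℕ) : Prop := ∀ (k : Pt → ℕ) (l : List Pt) (b : Pt) (kb : ℕ),
  Good (b :: l) → l.length + 1 ≤ n → ¬ red b → Exm l b → 1 ≤ kb → B2 red k l →
  tot red k l = kb → TrAt red b kb l (K red k)

/-- induction hypothesis with two special blue points -/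
def PT (red : Pt → Prop) (n : ℕ) : Prop := ∀ (k : Pt → ℕ) (l : List Pt) (a p : Pt) (kp : ℕ),
  Good (a :: p :: l) → l.length + 2 ≤ n → ¬ red a → ¬ red p → k a = 1 → 1 ≤ kp →
  Exm (p :: l) a → Exm (a :: l) p → (∃ x ∈ l, red x ∧ (Sees l a x ∨ Sees l p x)) → B2 red k l →
  tot red k l = kp → TrAt red p kp (a :: l) (K red k)

/-- no special point -/
def PG (red : Pt → Prop) (n : ℕ) : Prop := ∀ (k : Pt → ℕ) (l : List Pt),
  Good l → l.length ≤ n → B2 red k l → tot red k l = 1 → Tr red l (K red k)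

variable {n : ℕ}

lemma ext_line {e : ℝ} {v y : Pt} {l : List Pt} (h : ∀ t ∈ l, 0 < D e v y t) (hne : v ≠ y) :
    Exm (v :: l) y := by
  refine ext_side (e := -e) (q := v) ?_ hne
  intro t ht h1 h2
  rcases List.mem_cons.1 ht with rfl | ht
  · exact absurd rfl h2
  · rw [D_neg, D_swap', neg_neg]; exact h t ht

lemma ext_line' {e : ℝ} {v y : Pt} {l : List Pt} (h : ∀ t ∈ l, 0 < D e v t y) (hne : v ≠ y) :
    Exm (v :: l) y := by
  refine ext_line (e := -e) ?_ hne
  intro t ht; rw [D_neg']; exact h t ht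

lemma GvB (hPQ : PQ red n) {e : ℝ} {v y : Pt} {l : List Pt} (hG : Good (v :: y :: l))
    (hlen : l.length + 1 ≤ n) (hv : red v) (hy : ¬ red y) (hs : ∀ t ∈ l, 0 < D e v y t)
    (hB : B2 red k (y :: l)) (ht : tot red k (y :: l) = 0) : TrAt red v 1 (y :: l) (K red k) := by
  have hn := hG.1
  simp only [List.nodup_cons, List.mem_cons] at hn
  push Not at hn
  have hk := hB y (by simp) hy
  rw [tot_cons, wt_blue hy] at ht
  have h := hPQ k l y (k y - 1) (hG.sub (by intro _; simp only [cnt_cons, List.count_append, List.count_nil]; omega)) hlen hy ((ext_line hs hn.1.1).mono (by intro _; simp only [List.mem_cons, List.mem_append, List.not_mem_nil]; tauto))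
    (by omega) (hB.mono (by intro _; simp only [List.mem_cons, List.mem_append, List.not_mem_nil]; tauto)) (by omega)
  exact hang h hG (opp' hv hy) (by rw [K_blue hy]; omega) hs

lemma GvB' (hPQ : PQ red n) {e : ℝ} {v y : Pt} {l : List Pt} (hG : Good (v :: y :: l))
    (hlen : l.length + 1 ≤ n) (hv : red v) (hy : ¬ red y) (hs : ∀ t ∈ l, 0 < D e v t y)
    (hB : B2 red k (y :: l)) (ht : tot red k (y :: l) = 0) : TrAt red v 1 (y :: l) (K red k) :=
  GvB hPQ (e := -e) hG hlen hv hy (fun t h => by rw [D_neg']; exact hs t h) hB ht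

lemma cnt_of_perm {l l' : List Pt} (h : l.Perm l') : ∀ a, l.count a = l'.count a :=
  fun a => h.count_eq a

lemma Gv (hPQ : PQ red n) {v : Pt} {l : List Pt} (hG : Good (v :: l))
    (hlen : l.length ≤ n) (hv : red v) (hE : Exm l v)
    (hB : B2 red k l) (ht : tot red k l = 0) : TrAt red v 2 l (K red k) := by
  obtain ⟨l', hp, hs⟩ := sort_ex one_ne_zero hE hG
  refine TrAt.perm (l := l') ?_ (cnt_of_perm hp.symm)
  have hG : Good (v :: l') := hG.sub (fun a => by
    have := cnt_of_perm hp a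
    simp only [cnt_cons]; omega)
  have hlen : l'.length ≤ n := by rw [← hp.length_eq]; exact hlen
  have hB : B2 red k l' := hB.mono (fun t h => hp.mem_iff.2 h)
  have ht : tot red k l' = 0 := by rw [← tot_perm hp]; exact ht
  clear hE hp
  rcases List.eq_nil_or_concat l' with rfl | ⟨l0, o, rfl⟩
  · exact TrAt_nil
  rw [List.concat_eq_append] at *
  by_cases ho : red o
  swap
  · refine (TrAt.perm (l := o :: l0) ?_ (by intro _; simp only [cnt_cons, List.count_append, List.count_nil]; omega)).mono (m1 := 1) (by omega) (fun _ _ => le_rfl)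
    refine GvB' hPQ (e := 1) (hG.sub (by intro _; simp only [cnt_cons, List.count_append, List.count_nil]; omega)) (by simp only [List.length_cons, List.length_append, List.length_nil] at *; omega) hv ho ?_ (hB.mono (by intro _; simp only [List.mem_cons, List.mem_append, List.not_mem_nil]; tauto))
      (by simp only [tot_cons, tot_append, tot_nil] at *; omega)
    exact (srt_mid hs).1
  by_cases hh : ∃ y l1, l0 = y :: l1 ∧ ¬ red y
  · obtain ⟨y, l1, rfl, hy⟩ := hh
    refine TrAt.mono (m1 := 1) ?_ (by omega) (fun _ _ => le_rfl)
    refine GvB hPQ (e := 1) (l := l1 ++ [o]) hG (by simp only [List.length_cons, List.length_append, List.length_nil] at *; omega) hv hy ?_ hB ht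
    have := srt_mid (L := []) (z := y) (N := l1 ++ [o]) hs
    exact this.2.1
  push Not at hh
  rw [tot_append, tot_cons, tot_nil, wt_red ho] at ht
  obtain ⟨L, z, N, rfl, hz, h1, h2, h3⟩ := first_neg (red := red) (k := k) (l := l0) 0 le_rfl (by omega)
  have hs' : Srt 1 v (L ++ z :: (N ++ [o])) := by
    simpa using hs
  obtain ⟨s1, s2, s3⟩ := srt_mid hs'
  rw [tot_append, tot_cons, wt_blue hz] at ht
  have hkz := hB z (by simp) hz
  rcases h3 with rfl | ⟨L', y, rfl, h3⟩
  · exact absurd (hh z N rfl) hz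
  have hn := hG.1
  have hvz : v ≠ z := by
    rintro rfl; simp at hn
  by_cases hα : tot red k (L' ++ [y]) = 0
  · have hy : ¬ red y := by
      intro hy
      rw [tot_append, tot_cons, tot_nil, wt_red hy] at hα
      omega
    have t1 : TrAt red v 1 (y :: L') (K red k) := by
      refine GvB' hPQ (e := 1) (hG.sub (by intro _; simp only [cnt_cons, List.count_append, List.count_nil]; omega)) (by simp only [List.length_cons, List.length_append, List.length_nil] at *; omega) hv hy ?_ (hB.mono (by intro _; simp only [List.mem_cons, List.mem_append, List.not_mem_nil]; tauto))
        (by simp only [tot_cons, tot_append, tot_nil] at *; omega)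
      have : Srt 1 v (L' ++ y :: (z :: (N ++ [o]))) := by simpa using hs
      exact (srt_mid this).1
    have t2 : TrAt red v 1 (z :: (N ++ [o])) (K red k) := by
      refine GvB hPQ (e := 1) (hG.sub (by intro _; simp only [cnt_cons, List.count_append, List.count_nil]; omega)) (by simp only [List.length_cons, List.length_append, List.length_nil] at *; omega) hv hz s2 (hB.mono (by intro _; simp only [List.mem_cons, List.mem_append, List.not_mem_nil]; tauto))
        (by simp only [tot_cons, tot_append, tot_nil, wt_red ho, wt_blue hz] at *; omega)
    have t3 := glueD (-1) z t2 t1 (hG.sub (by intro _; simp only [cnt_cons, List.count_append, List.count_nil]; omega)) (by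
      intro t ht
      rw [D_neg]
      rcases List.mem_cons.1 ht with rfl | ht
      · rw [D_self]; simp
      · have := s2 t ht; linarith) (by
      intro t ht
      rw [D_neg']
      exact s1 t (by simpa [or_comm] using ht))
    exact t3.perm (by intro _; simp only [cnt_cons, List.count_append, List.count_nil]; omega)
  · obtain ⟨α, hα'⟩ := Int.eq_ofNat_of_zero_le (show 0 ≤ tot red k (L' ++ [y]) by omega)
    have t1 := hPQ k (L' ++ [y]) z α (hG.sub (by intro _; simp only [cnt_cons, List.count_append, List.count_nil]; omega)) (by simp only [List.length_cons, List.length_append, List.length_nil] at *; omega) hz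
      ((ext_line' s1 hvz).mono (by intro _; simp only [List.mem_cons, List.mem_append, List.not_mem_nil]; tauto)) (by omega) (hB.mono (by intro _; simp only [List.mem_cons, List.mem_append, List.not_mem_nil]; tauto)) hα'
    have t2 := hPQ k (N ++ [o]) z (k z - 1 - α) (hG.sub (by intro _; simp only [cnt_cons, List.count_append, List.count_nil]; omega)) (by simp only [List.length_cons, List.length_append, List.length_nil] at *; omega) hz
      ((ext_line s2 hvz).mono (by intro _; simp only [List.mem_cons, List.mem_append, List.not_mem_nil]; tauto)) (by omega) (hB.mono (by intro _; simp only [List.mem_cons, List.mem_append, List.not_mem_nil]; tauto))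
        (by simp only [tot_cons, tot_append, tot_nil, wt_red ho, wt_blue hz] at *; omega)
    have t3 := join t1 t2 (v := v) (e := 1) (hG.sub (by intro _; simp only [cnt_cons, List.count_append, List.count_nil]; omega)) (opp' hv hz) (by rw [K_blue hz]; omega)
      s1 s2
    exact (t3.mono (m2 := 2) (by omega) (fun _ _ => le_rfl)).perm (by intro _; simp only [cnt_cons, List.count_append, List.count_nil]; omega)

lemma exists_ext (l : List Pt) (h : l ≠ []) : ∃ u ∈ l, Exm l u := by
  obtain ⟨u, hu, hm⟩ := l.toFinset.exists_max_image (fun t => t.1^2+t.2^2)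
    ⟨l.head h, by simp⟩
  refine ⟨u, by simpa using hu, -u.1, -u.2, fun t ht hne => ?_⟩
  have h1 := hm t (by simpa using ht)
  have h2 := ne_sq hne
  simp only [F] at *
  nlinarith

lemma PG_succ (hPQ : PQ red n) : PG red (n+1) := by
  intro k l hG hlen hB ht
  have hne : l ≠ [] := by rintro rfl; rw [tot_nil] at ht; omega
  obtain ⟨u, hu, hE⟩ := exists_ext l hne
  have hp := List.perm_cons_erase hu
  generalize l.erase u = l1 at hp
  have cp := cnt_of_perm hp
  suffices TrAt red u (K red k u) l1 (K red k) by
    obtain ⟨E, h1, h2⟩ := this.tr le_rfl (fun _ _ => le_rfl)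
    exact ⟨E, h1.perm hp.symm, fun v hv => h2 v (hp.mem_iff.1 hv)⟩
  have hG : Good (u :: l1) := hG.sub (fun a => (cp a).ge)
  have hlen : l1.length ≤ n := by have := hp.length_eq; simp at this; omega
  have hB : B2 red k (u :: l1) := hB.mono (fun t h => hp.mem_iff.2 h)
  have hE : Exm l1 u := hE.mono (fun t h => hp.mem_iff.2 (by simp [h]))
  rw [tot_perm hp, tot_cons] at ht
  clear hp cp hu hne
  by_cases hr : red u
  · rw [wt_red hr] at ht
    exact (Gv hPQ hG hlen hr hE (hB.mono (by intro _; simp only [List.mem_cons, List.mem_append, List.not_mem_nil]; tauto)) (by omega)).mono (by rw [K_red hr]; omega) (fun _ _ => le_rfl)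
  rw [wt_blue hr] at ht
  have hku := hB u (by simp) hr
  obtain ⟨l', hp, hs⟩ := sort_ex one_ne_zero hE hG
  refine TrAt.perm (l := l') ?_ (cnt_of_perm hp.symm)
  obtain ⟨L, r, N, rfl, hrr, h0⟩ := first_one (red := red) (k := k) (l := l') 0 (by
    intro t h h'
    have := hB t (by simp [hp.mem_iff.2 h]) h'
    omega) le_rfl (by rw [← tot_perm hp]; omega)
  have hG : Good (u :: (L ++ r :: N)) := hG.sub (fun a => by
    have := cnt_of_perm hp a
    simp only [cnt_cons] at *; omega)
  have hB : B2 red k (L ++ r :: N) := hB.mono (fun t h => by simp [hp.mem_iff.2 h])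
  have ht : 1 - (k u : ℤ) + tot red k (L ++ r :: N) = 1 := by rw [← tot_perm hp]; exact ht
  have hlen : (L ++ r :: N).length ≤ n := by rw [← hp.length_eq]; exact hlen
  clear hp hE
  obtain ⟨s1, s2, s3⟩ := srt_mid hs
  rw [tot_append, tot_cons, wt_red hrr] at ht
  have hn := hG.1
  have hur : u ≠ r := by rintro rfl; simp at hn
  have t1 := Gv hPQ (v := r) (l := L) (hG.sub (by intro _; simp only [cnt_cons, List.count_append, List.count_nil]; omega)) (by simp only [List.length_cons, List.length_append, List.length_nil] at *; omega) hrr ((ext_line' s1 hur).mono (by intro _; simp only [List.mem_cons, List.mem_append, List.not_mem_nil]; tauto)) (hB.mono (by intro _; simp only [List.mem_cons, List.mem_append, List.not_mem_nil]; tauto)) (by omega)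
  have t2 := hang (v := u) (e := -1) t1 (hG.sub (by intro _; simp only [cnt_cons, List.count_append, List.count_nil]; omega)) (opp hrr hr) (by rw [K_red hrr]) (by
    intro t ht; rw [D_neg']; exact s1 t ht)
  have t3 := hPQ k N u (k u - 1) (hG.sub (by intro _; simp only [cnt_cons, List.count_append, List.count_nil]; omega)) (by simp only [List.length_cons, List.length_append, List.length_nil] at *; omega) hr ((ext_side (e := 1) (q := r) (fun t ht _ _ => s2 t ht) hur.symm))
    (by omega) (hB.mono (by intro _; simp only [List.mem_cons, List.mem_append, List.not_mem_nil]; tauto)) (by omega)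
  have t4 := glueD 1 r t2 t3 (hG.sub (by intro _; simp only [cnt_cons, List.count_append, List.count_nil]; omega)) (by
    intro t ht
    rcases List.mem_cons.1 ht with rfl | ht
    · rw [D_self]
    · rw [D_swap]; have := s1 t ht; linarith) s2
  exact (t4.mono (by rw [K_blue hr]; omega) (fun _ _ => le_rfl)).perm (by intro _; simp only [cnt_cons, List.count_append, List.count_nil]; omega)

lemma PQ_succ (hPQ : PQ red n) (hPT : PT red n) : PQ red (n+1) := by
  intro k l b kb hG hlen hb hE hkb hB ht
  have hn := hG.1
  simp only [List.nodup_cons] at hn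
  let k' : Pt → ℕ := Function.update k b kb
  have e1 : k' b = kb := by simp [k']
  have e2 : ∀ t ∈ l, k t = k' t := fun t ht => by
    have : t ≠ b := by rintro rfl; exact hn.1 ht
    simp [k', this]
  have hB' : B2 red k' l := fun t h1 h2 => by rw [← e2 t h1]; exact hB t h1 h2
  have ht' : tot red k' l = kb := by rw [← tot_congr e2]; exact ht
  suffices TrAt red b kb l (K red k') from
    this.mono le_rfl (fun t h => (K_congr (e2 t h)).ge)
  clear_value k'
  clear e2 hB ht
  by_cases hk2 : 2 ≤ kb
  · have := PG_succ hPQ k' (b :: l) hG (by simpa using hlen) (by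
      intro t h1 h2
      rcases List.mem_cons.1 h1 with rfl | h1
      · omega
      · exact hB' t h1 h2) (by rw [tot_cons, wt_blue hb]; omega)
    exact this.at (fun _ => rfl) (by rw [K_blue hb]; omega) (fun _ _ => le_rfl)
  have hkb1 : kb = 1 := by omega
  subst hkb1
  clear hk2 hkb
  obtain ⟨l', hp, hs⟩ := sort_ex one_ne_zero hE hG
  refine TrAt.perm (l := l') ?_ (cnt_of_perm hp.symm)
  replace hG : Good (b :: l') := hG.sub (fun a => by
    have := cnt_of_perm hp a
    simp only [cnt_cons]; omega)
  replace hlen : l'.length ≤ n := by rw [← hp.length_eq]; omega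
  replace hB : B2 red k' l' := hB'.mono (fun t h => hp.mem_iff.2 h)
  replace ht : tot red k' l' = 1 := by rw [← tot_perm hp]; exact ht'
  replace hE : Exm l' b := hE.mono (fun t h => hp.mem_iff.2 h)
  clear hp hn hB' ht'
  rcases l' with _ | ⟨d, l1⟩
  · rw [tot_nil] at ht; omega
  have s2 := (srt_mid (L := []) hs).2.1
  rw [tot_cons] at ht
  have hn := hG.1
  have hbd : b ≠ d := by rintro rfl; simp at hn
  have hEd := ext_line s2 hbd
  by_cases hd : red d
  · rw [wt_red hd] at ht
    have t1 := Gv hPQ (v := d) (l := l1) (hG.sub (by intro _; simp only [cnt_cons, List.count_append, List.count_nil]; omega)) (by simp only [List.length_cons, List.length_append, List.length_nil] at *; omega) hd (hEd.mono (by intro _; simp only [List.mem_cons, List.mem_append, List.not_mem_nil]; tauto)) (hB.mono (by intro _; simp only [List.mem_cons, List.mem_append, List.not_mem_nil]; tauto)) (by omega)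
    exact hang t1 hG (opp hd hb) (by rw [K_red hd]) s2
  rw [wt_blue hd] at ht
  have hkd := hB d (by simp) hd
  obtain ⟨l2, hp, hs2⟩ := sort_ex (e := -1) (by norm_num) (hEd.mono (l' := l1) (by intro _; simp only [List.mem_cons, List.mem_append, List.not_mem_nil]; tauto)) (hG.sub (by intro _; simp only [cnt_cons, List.count_append, List.count_nil]; omega))
  refine TrAt.perm (l := d :: l2) ?_ (fun a => by
    have := cnt_of_perm hp a
    simp only [cnt_cons]; omega)
  replace hG : Good (b :: d :: l2) := hG.sub (fun a => by
    have := cnt_of_perm hp a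
    simp only [cnt_cons]; omega)
  replace hlen : l2.length + 1 ≤ n := by rw [← hp.length_eq]; simpa using hlen
  replace hB : B2 red k' l2 := hB.mono (fun t h => by simp [hp.mem_iff.2 h])
  replace ht : 1 - (k' d : ℤ) + tot red k' l2 = 1 := by rw [← tot_perm hp]; exact ht
  replace hE : Exm (d :: l2) b := hE.mono (fun t h => by simpa [hp.mem_iff] using h)
  replace hEd : Exm (b :: l2) d := hEd.mono (fun t h => by simpa [hp.mem_iff] using h)
  replace s2 : ∀ t ∈ l2, 0 < D 1 b d t := fun t h => s2 t (hp.mem_iff.2 h)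
  clear hp hs hn
  obtain ⟨L, r, N, rfl, hrr, h0⟩ := first_one (red := red) (k := k') (l := l2) 0 (by
    intro t h h'
    have := hB t h h'
    omega) le_rfl (by omega)
  obtain ⟨r1, r2, r3⟩ := srt_mid hs2
  rw [tot_append, tot_cons, wt_red hrr] at ht
  have hNne : 1 ≤ N.length := by
    rcases N with _ | ⟨_, _⟩
    · rw [tot_nil] at ht; omega
    · simp
  have t1 := hPT k' (r :: L) b d 1 (hG.sub (by intro _; simp only [cnt_cons, List.count_append, List.count_nil]; omega)) (by simp only [List.length_cons, List.length_append, List.length_nil] at *; omega) hb hd e1 le_rfl (hE.mono (by intro _; simp only [List.mem_cons, List.mem_append, List.not_mem_nil]; tauto)) (hEd.mono (by intro _; simp only [List.mem_cons, List.mem_append, List.not_mem_nil]; tauto))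
    ⟨r, by simp, hrr, Or.inr (sees_side (e := 1) (by
      intro t h1 h2
      have h1 : t ∈ L := by simpa [h2] using h1
      have := r1 t h1
      rwa [D_neg'] at this))⟩ (hB.mono (by intro _; simp only [List.mem_cons, List.mem_append, List.not_mem_nil]; tauto)) (by rw [tot_cons, wt_red hrr]; omega)
  have t2 := hPQ k' N d (k' d - 1) (hG.sub (by intro _; simp only [cnt_cons, List.count_append, List.count_nil]; omega)) (by simp only [List.length_cons, List.length_append, List.length_nil] at *; omega) hd (hEd.mono (by intro _; simp only [List.mem_cons, List.mem_append, List.not_mem_nil]; tauto)) (by omega) (hB.mono (by intro _; simp only [List.mem_cons, List.mem_append, List.not_mem_nil]; tauto)) (by omega)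
  have t3 := glueD (-1) r t1 t2 (hG.sub (by intro _; simp only [cnt_cons, List.count_append, List.count_nil]; omega)) (by
    intro t h1
    simp only [List.mem_cons] at h1
    rcases h1 with rfl | rfl | h1
    · have := s2 r (by simp)
      have e : D (-1) d r t = - D 1 t d r := by simp only [D, cr]; ring
      rw [e]; linarith
    · rw [D_self]
    · have := r1 t h1; rw [D_swap]; linarith) r2
  refine t3.swap (by rw [K_blue hd]; omega) (by intro _; simp only [cnt_cons, List.count_append, List.count_nil]; omega) (by simp) (by rw [K_blue hb]; omega) (fun _ _ _ => le_rfl)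

/-- Lemma E. -/
lemma lemE (hPT : PT red n) {e : ℝ} {a y z : Pt} {U : List Pt} (hG : Good (x :: a :: U))
    (hlen : U.length + 1 ≤ n) (hx : red x) (ha : ¬ red a) (hka : k a = 1)
    (hy : y ∈ U) (hyb : ¬ red y) (hyU : ∀ t ∈ U, t ≠ y → 0 < D e x y t)
    (hz : z ∈ U) (hzr : red z) (hzU : ∀ t ∈ U, t ≠ z → 0 < D e x t z)
    (hay : 0 < D e x y a) (haz : 0 < D e x a z) (hE : Exm (x :: U) a)
    (hB : B2 red k U) (ht : tot red k U = 0) : TrAt red x 1 (a :: U) (K red k) := by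
  have hn := hG.1
  simp only [List.nodup_cons, List.mem_cons] at hn
  push Not at hn
  have hyz : y ≠ z := by rintro rfl; exact hyb hzr
  obtain ⟨α, β, p, q, hp, hpb, hq, hqr, hpos, hpq, hmin⟩ := ivt (red := red) (o := x) (v1 := y) (q1 := z)
    (α0 := -e*(y.2-x.2)) (β0 := e*(y.1-x.1)) (α1 := e*(z.2-x.2)) (β1 := -e*(z.1-x.1))
    (U := U) (fun p hp q hq r hr => hG.2 p (by simp [hp]) q (by simp [hq]) r (by simp [hr]))
    hy hyb (by rw [D_F, D_self]) (fun t h1 h2 => by rw [D_F]; exact hyU t h1 h2) hz hzr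
    (by rw [D_F', D_self, neg_zero])
    (fun t h1 h2 => by rw [D_F', D_self, neg_zero, D_F', ← D_swap]; exact hzU t h1 h2)
  have hle : ∀ t ∈ U, F α β x p ≤ F α β x t := by
    intro t h
    by_cases h1 : t = p
    · rw [h1]
    by_cases h2 : t = q
    · rw [h2, hpq]
    exact (hmin t h h1 h2).le
  have hfa : F α β x p < F α β x a := by
    by_contra! hc
    obtain ⟨α', β', hE⟩ := hE
    have ex := hE x (by simp) hn.1.1
    have ey := hE y (by simp [hy]) (by rintro rfl; exact hn.2.1 hy)
    have ez := hE z (by simp [hz]) (by rintro rfl; exact hn.2.1 hz)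
    have i1 := plucker α β e x y a z
    have i2 : D e x a z * F α' β' a y + D e x y a * F α' β' a z
      + (D e x y z - D e x a z - D e x y a) * F α' β' a x = 0 := by
      simp only [D, cr, F]; ring
    have dyz := hzU y hy hyz
    have m1 := mul_le_mul_of_nonneg_left (hle y hy) haz.le
    have m2 := mul_le_mul_of_nonneg_left (hle z hz) hay.le
    have m3 := mul_le_mul_of_nonneg_left hc dyz.le
    have m4 : 0 ≤ D e x y z - D e x a z - D e x y a := by
      by_contra! h
      have := mul_neg_of_pos_of_neg hpos h
      nlinarith
    have m5 := mul_pos haz ey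
    have m6 := mul_pos hay ez
    have m7 := mul_nonneg m4 ex.le
    linarith
  have hpr := List.perm_cons_erase hp
  generalize U.erase p = V at hpr
  have cp := cnt_of_perm hpr
  simp only [cnt_cons] at cp
  have hpqne : p ≠ q := by rintro rfl; exact hpb hqr
  have hqV : q ∈ V := by
    have := hpr.mem_iff.1 hq
    simpa [hpqne.symm] using this
  have hVU : ∀ t ∈ V, t ∈ U := fun t h => hpr.mem_iff.2 (by simp [h])
  have hkp := hB p hp hpb
  have G2 : Good (x :: a :: p :: V) := hG.sub (fun a => by
    have := cp a
    simp only [cnt_cons]; omega)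
  have n2 := G2.1
  simp only [List.nodup_cons, List.mem_cons] at n2
  push Not at n2
  rw [tot_perm hpr, tot_cons, wt_blue hpb] at ht
  have hlV : V.length + 2 ≤ n := by
    have := hpr.length_eq
    simp at this; omega
  have t1 := hPT k V a p (k p - 1) (G2.sub (by intro _; simp only [cnt_cons, List.count_append, List.count_nil]; omega)) hlV ha hpb hka (by omega)
    (hE.mono (fun t h => by simp [hpr.mem_iff, List.mem_cons.1 h]))
    (by
      refine ext_tangent (α := α) (β := β) (q := q) ?_ ?_ hpqne.symm
      · intro t h1 h2 h3
        rw [← F_sub α β x]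
        rcases List.mem_cons.1 h1 with rfl | h1
        · linarith
        · have := hmin t (hVU t h1) h2 h3; linarith
      · rw [← F_sub α β x]; linarith)
    ⟨q, hqV, hqr, Or.inr ⟨α, β, by
      intro t h1 h2
      have : t ≠ p := by rintro rfl; exact n2.2.2.1 h1
      have := hmin t (hVU t h1) this h2
      rw [← F_sub α β x]; linarith, by rw [← F_sub α β x]; linarith⟩⟩
    (hB.mono hVU) (by omega)
  have t2 := hang_pos (α := -α) (β := -β) (v := x) t1 (G2.sub (by intro _; simp only [cnt_cons, List.count_append, List.count_nil]; omega)) (opp' hx hpb) (by rw [K_blue hpb]; omega) (by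
    intro t h
    have e : F (-α) (-β) p t = F α β x p - F α β x t := by simp only [F]; ring
    rw [e]
    rcases List.mem_cons.1 h with rfl | h
    · linarith
    · have := hle t (hVU t h); linarith) (by
    have e : F (-α) (-β) p x = F α β x p := by simp only [F]; ring
    rw [e]; exact hpos)
  exact t2.perm (fun b => by
    have := cp b
    simp only [cnt_cons] at *; omega)


/-- Case (i) when both extreme neighbours are blue. -/
lemma BBi (hPQ : PQ red n) (hPT : PT red n) {e : ℝ} {a y z : Pt} {A C M : List Pt}
    (hs : Srt e x (y :: (A ++ C ++ a :: (M ++ [z]))))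
    (hG : Good (x :: y :: (A ++ C ++ a :: (M ++ [z]))))
    (hlen : A.length + C.length + M.length + 2 ≤ n) (hx : red x) (ha : ¬ red a) (hka : k a = 1)
    (hyb : ¬ red y) (hzb : ¬ red z) (hE : Exm (x :: y :: (A ++ C ++ M ++ [z])) a)
    (hB : B2 red k (y :: (A ++ C ++ M ++ [z]))) (ht : tot red k (y :: (A ++ C ++ M ++ [z])) = 0)
    (hp : 0 < tot red k (y :: A)) : TrAt red x 2 (a :: y :: (A ++ C ++ M ++ [z])) (K red k) := by
  have hky := hB y (by simp) hyb
  rw [tot_cons, wt_blue hyb] at hp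
  obtain ⟨L, r, N, rfl, hrr, h0⟩ := first_one (red := red) (k := k) (l := A) (1 - (k y : ℤ)) (by
    intro t h h'
    have := hB t (by simp [h]) h'
    omega) (by omega) hp
  have hs1 : Srt e x ([] ++ y :: (L ++ r :: (N ++ C ++ a :: (M ++ [z])))) := by simpa using hs
  have hs2 : Srt e x ((y :: L) ++ r :: (N ++ C ++ a :: (M ++ [z]))) := by simpa using hs
  have hs3 : Srt e x ((y :: (L ++ r :: (N ++ C ++ a :: M))) ++ z :: []) := by simpa using hs
  have s1 := (srt_mid hs1).2.1
  obtain ⟨s2, s3, -⟩ := srt_mid hs2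
  have s4 := (srt_mid hs3).1
  simp only [tot_cons, tot_append, tot_nil, wt_red hrr, wt_blue hyb] at ht
  have t1 : TrAt red x 1 (y :: L) (K red k) :=
    GvB hPQ (e := e) (hG.sub (by intro _; simp only [cnt_cons, List.count_append, List.count_nil]; omega)) (by simp only [List.length_cons, List.length_append, List.length_nil] at *; omega) hx hyb (fun t h => s1 t (by simp [h])) (hB.mono (by intro _; simp only [List.mem_cons, List.mem_append, List.not_mem_nil]; tauto))
      (by rw [tot_cons, wt_blue hyb]; omega)
  have t2 : TrAt red x 1 (a :: (r :: (N ++ C ++ M ++ [z]))) (K red k) := by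
    refine lemE hPT (e := -e) (y := z) (z := r) (hG.sub (by intro _; simp only [cnt_cons, List.count_append, List.count_nil]; omega)) (by simp only [List.length_cons, List.length_append, List.length_nil] at *; omega) hx ha hka (by simp) hzb ?_ (by simp) hrr ?_
      ?_ ?_ (hE.mono (by intro _; simp only [List.mem_cons, List.mem_append, List.not_mem_nil]; tauto)) (hB.mono (by intro _; simp only [List.mem_cons, List.mem_append, List.not_mem_nil]; tauto)) ?_
    · intro t h1 h2
      rw [D_neg']
      apply s4
      simp only [List.mem_cons, List.mem_append, List.not_mem_nil] at *; tauto
    · intro t h1 h2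
      rw [D_neg']
      apply s3
      simp only [List.mem_cons, List.mem_append, List.not_mem_nil] at *; tauto
    · rw [D_neg']; apply s4; simp
    · rw [D_neg']; apply s3; simp
    · simp only [tot_cons, tot_append, tot_nil, wt_red hrr]; omega
  have t3 := glueD (-e) r t2 t1 (hG.sub (by intro _; simp only [cnt_cons, List.count_append, List.count_nil]; omega)) (by
    intro t h
    by_cases h2 : t = r
    · rw [h2, D_self]
    rw [D_neg]
    have := s3 t (by simp only [List.mem_cons, List.mem_append, List.not_mem_nil] at *; tauto)
    linarith) (by
    intro t h
    rw [D_neg']; exact s2 t h)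
  exact t3.perm (by intro _; simp only [cnt_cons, List.count_append, List.count_nil]; omega)

set_option maxHeartbeats 800000 in
/-- the special point lies in the cone of `U` at `x` -/
lemma AU (hPQ : PQ red n) (hPT : PT red n) {e : ℝ} (he : e ≠ 0) {a y z : Pt} {U : List Pt}
    (hG : Good (x :: a :: U))
    (hlen : U.length ≤ n) (hx : red x) (ha : ¬ red a) (hka : k a = 1)
    (hy : y ∈ U) (hyU : ∀ t ∈ U, t ≠ y → 0 < D e x y t)
    (hz : z ∈ U) (hzU : ∀ t ∈ U, t ≠ z → 0 < D e x t z)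
    (hyz : ¬ red y ∨ ¬ red z)
    (hay : 0 < D e x y a) (haz : 0 < D e x a z) (hE : Exm (x :: U) a)
    (hB : B2 red k U) (ht : tot red k U = 0) (hlen' : U.length + 1 ≤ n) :
    TrAt red x 2 (a :: U) (K red k) := by
  by_cases hyr : red y
  · have hzb : ¬ red z := by tauto
    refine (lemE hPT (e := -e) (y := z) (z := y) hG hlen' hx ha hka hz hzb ?_ hy hyr ?_ ?_ ?_ hE hB ht).mono
      (by omega) (fun _ _ => le_rfl)
    · intro t h1 h2; rw [D_neg']; exact hzU t h1 h2
    · intro t h1 h2; rw [D_neg']; exact hyU t h1 h2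
    · rw [D_neg']; exact haz
    · rw [D_neg']; exact hay
  by_cases hzr : red z
  · exact (lemE hPT hG hlen' hx ha hka hy hyr hyU hz hzr hzU hay haz hE hB ht).mono
      (by omega) (fun _ _ => le_rfl)
  have hn := hG.1
  simp only [List.nodup_cons, List.mem_cons] at hn
  push Not at hn
  have hxy : y ≠ x := by rintro rfl; exact hn.1.2 hy
  have hEx : Exm (a :: U) x := by
    refine ext_side (e := e) (q := y) ?_ hxy
    intro t h1 h2 h3
    rcases List.mem_cons.1 h1 with rfl | h1
    · exact hay
    · exact hyU t h1 h3
  obtain ⟨l', hp, hs⟩ := sort_ex he (hEx.mono (l' := U) (by intro _; simp only [List.mem_cons, List.mem_append, List.not_mem_nil]; tauto)) (hG.sub (by intro _; simp only [cnt_cons, List.count_append, List.count_nil]; omega))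
  obtain ⟨M1, M2, rfl, hsa⟩ := ins (a := a) (hEx.mono (fun t h => by simpa [hp.mem_iff] using h)) (Ne.symm hn.1.1)
    (fun h => hn.1.2 (hp.mem_iff.2 h)) hs (by
      intro t h
      have h := hp.mem_iff.2 h
      have : cr x t a ≠ 0 := hG.2 x (by simp) t (by simp [h]) a (by simp)
        (by rintro rfl; exact hn.1.2 h) hn.1.1 (by rintro rfl; exact hn.2.1 h)
      exact mul_ne_zero he this)
  have cp := cnt_of_perm hp
  refine TrAt.perm (l := a :: (M1 ++ M2)) ?_ (fun b => by
    have := cp b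
    simp only [cnt_cons]; omega)
  replace hG : Good (x :: a :: (M1 ++ M2)) := hG.sub (fun b => by
    have := cp b
    simp only [cnt_cons]; omega)
  replace hlen : M1.length + M2.length + 1 ≤ n := by
    have := hp.length_eq
    simp only [List.length_append] at this
    omega
  replace hB : B2 red k (M1 ++ M2) := hB.mono (fun t h => hp.mem_iff.2 h)
  replace hE : Exm (x :: (M1 ++ M2)) a := hE.mono (fun t h => by simpa [hp.mem_iff] using h)
  replace ht : tot red k (M1 ++ M2) = 0 := by rw [← tot_perm hp]; exact ht
  replace hy := hp.mem_iff.1 hy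
  replace hz := hp.mem_iff.1 hz
  replace hyU : ∀ t ∈ M1 ++ M2, t ≠ y → 0 < D e x y t := fun t h => hyU t (hp.mem_iff.2 h)
  replace hzU : ∀ t ∈ M1 ++ M2, t ≠ z → 0 < D e x t z := fun t h => hzU t (hp.mem_iff.2 h)
  replace hs := hsa
  clear hp cp hEx hn hsa
  obtain ⟨s1, s2, s3⟩ := srt_mid hs
  have hy1 : y ∈ M1 := by
    rcases List.mem_append.1 hy with h | h
    · exact h
    · have := s2 y h; rw [D_swap] at this; linarith
  have hz2 : z ∈ M2 := by
    rcases List.mem_append.1 hz with h | h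
    · have := s1 z h; rw [D_swap] at this; linarith
    · exact h
  obtain ⟨M1', rfl⟩ : ∃ M, M1 = y :: M := by
    rcases M1 with _ | ⟨h, M⟩
    · simp at hy1
    refine ⟨M, ?_⟩
    by_cases hh : h = y
    · rw [hh]
    have h1 := hyU h (by simp) hh
    have h2 : y ∈ M := by simpa [Ne.symm hh] using hy1
    have h3 := (srt_mid (L := []) (z := h) (N := M ++ a :: M2) hs).2.1 y (by simp [h2])
    rw [D_swap] at h3; linarith
  obtain ⟨M2', rfl⟩ : ∃ M, M2 = M ++ [z] := by
    rcases List.eq_nil_or_concat M2 with rfl | ⟨M, h, rfl⟩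
    · simp at hz2
    rw [List.concat_eq_append] at *
    refine ⟨M, ?_⟩
    by_cases hh : h = z
    · rw [hh]
    have h1 := hzU h (by simp) hh
    have h2 : z ∈ M := by simpa [Ne.symm hh] using hz2
    have hs' : Srt e x ((y :: (M1' ++ a :: M)) ++ h :: []) := by simpa using hs
    have h3 := (srt_mid hs').1 z (by simp [h2])
    rw [D_swap] at h3; linarith
  clear hy1 hz2 hy hz hyz
  have hky := hB y (by simp) hyr
  have htt := ht
  simp only [tot_cons, tot_append, tot_nil, wt_blue hyr] at ht
  rcases lt_trichotomy (tot red k (y :: M1')) 0 with h | h | h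
  · have hr := hs.rev
    have := BBi hPQ hPT (k := k) (x := x) (e := -e) (a := a) (y := z) (z := y) (A := M2'.reverse) (C := []) (M := M1'.reverse)
      (by simpa using hr) (hG.sub (fun _ => by
        simp only [cnt_cons, List.count_append, List.count_nil, List.count_reverse]; omega))
      (by simp only [List.length_cons, List.length_append, List.length_nil, List.length_reverse] at *; omega)
      hx ha hka hzr hyr (hE.mono (by
        intro _; simp only [List.mem_cons, List.mem_append, List.not_mem_nil, List.mem_reverse]; tauto))
      (hB.mono (by
        intro _; simp only [List.mem_cons, List.mem_append, List.not_mem_nil, List.mem_reverse]; tauto))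
      (by simp only [tot_cons, tot_append, tot_nil, tot_rev, wt_blue hyr] at *; omega)
      (by simp only [tot_cons, tot_append, tot_nil, tot_rev, wt_blue hyr] at *; omega)
    exact this.perm (fun _ => by
        simp only [cnt_cons, List.count_append, List.count_nil, List.count_reverse]; omega)
  · rw [tot_cons, wt_blue hyr] at h
    rcases List.eq_nil_or_concat M1' with rfl | ⟨A, o, rfl⟩
    · rw [tot_nil] at h; omega
    rw [List.concat_eq_append] at *
    by_cases ho : red o
    · have hs1 : Srt e x ([] ++ y :: (A ++ [o] ++ a :: (M2' ++ [z]))) := by simpa using hs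
      have hs2 : Srt e x ((y :: A) ++ o :: (a :: (M2' ++ [z]))) := by simpa using hs
      have hs3 : Srt e x ((y :: (A ++ [o] ++ a :: M2')) ++ z :: []) := by simpa using hs
      have q1 := (srt_mid hs1).2.1
      obtain ⟨q2, q3, -⟩ := srt_mid hs2
      have q4 := (srt_mid hs3).1
      have t1 := hPT k (A ++ [o]) a y (k y - 1) (hG.sub (by intro _; simp only [cnt_cons, List.count_append, List.count_nil]; omega)) (by simp only [List.length_cons, List.length_append, List.length_nil] at *; omega) ha hyr hka (by omega) (hE.mono (by intro _; simp only [List.mem_cons, List.mem_append, List.not_mem_nil]; tauto))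
        ((ext_line (e := e) (v := x) (y := y) (l := a :: (A ++ [o])) (by
          intro t h; apply q1
          simp only [List.mem_cons, List.mem_append, List.not_mem_nil] at h ⊢; tauto) hxy.symm).mono (by intro _; simp only [List.mem_cons, List.mem_append, List.not_mem_nil]; tauto))
        ⟨o, by simp, ho, Or.inl (sees_beyond (e := -e) (x := x) (by
          intro t h1 h2
          rw [D_neg']
          exact q2 t (by simp only [List.mem_cons, List.mem_append, List.not_mem_nil] at h1 ⊢; tauto)) (by
          have := q3 a (by simp)
          rw [D_neg]; linarith))⟩ (hB.mono (by intro _; simp only [List.mem_cons, List.mem_append, List.not_mem_nil]; tauto)) (by omega)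
      have t2 := hang (v := x) (e := e) t1 (hG.sub (by intro _; simp only [cnt_cons, List.count_append, List.count_nil]; omega)) (opp' hx hyr) (by rw [K_blue hyr]; omega) (by
        intro t h; apply q1
        simp only [List.mem_cons, List.mem_append, List.not_mem_nil] at h ⊢; tauto)
      have t3 : TrAt red x 1 (z :: M2') (K red k) := GvB' hPQ (e := e) (hG.sub (by intro _; simp only [cnt_cons, List.count_append, List.count_nil]; omega)) (by simp only [List.length_cons, List.length_append, List.length_nil] at *; omega) hx hzr
        (fun t h => q4 t (by simp [h])) (hB.mono (by intro _; simp only [List.mem_cons, List.mem_append, List.not_mem_nil]; tauto)) (by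
          simp only [tot_cons, tot_append, tot_nil, tot_rev, wt_blue hyr] at *; omega)
      have t4 := glueD e a t2 t3 (hG.sub (by intro _; simp only [cnt_cons, List.count_append, List.count_nil]; omega)) (by
        intro t h
        by_cases h2 : t = a
        · rw [h2, D_self]
        have := s1 t (by simp only [List.mem_cons, List.mem_append, List.not_mem_nil] at h ⊢; tauto)
        rw [D_swap]; linarith) (by
        intro t h; apply s2
        simp only [List.mem_cons, List.mem_append, List.not_mem_nil] at h ⊢; tauto)
      exact t4.perm (by intro _; simp only [cnt_cons, List.count_append, List.count_nil]; omega)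
    · have hko := hB o (by simp) ho
      have := BBi hPQ hPT (k := k) (x := x) (e := e) (a := a) (y := y) (z := z) (A := A) (C := [o]) (M := M2')
        hs (hG.sub (by intro _; simp only [cnt_cons, List.count_append, List.count_nil]; omega)) (by simp only [List.length_cons, List.length_append, List.length_nil] at *; omega) hx ha hka hyr hzr (hE.mono (by intro _; simp only [List.mem_cons, List.mem_append, List.not_mem_nil]; tauto)) (hB.mono (by intro _; simp only [List.mem_cons, List.mem_append, List.not_mem_nil]; tauto))
        (by simp only [tot_cons, tot_append, tot_nil, wt_blue hyr] at *; omega)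
        (by simp only [tot_cons, tot_append, tot_nil, wt_blue hyr, wt_blue ho] at *; omega)
      exact this.perm (by intro _; simp only [cnt_cons, List.count_append, List.count_nil]; omega)
  · have := BBi hPQ hPT (k := k) (x := x) (e := e) (a := a) (y := y) (z := z) (A := M1') (C := []) (M := M2')
      (by simpa using hs) (hG.sub (by intro _; simp only [cnt_cons, List.count_append, List.count_nil]; omega)) (by simp only [List.length_cons, List.length_append, List.length_nil] at *; omega) hx ha hka hyr hzr (hE.mono (by intro _; simp only [List.mem_cons, List.mem_append, List.not_mem_nil]; tauto)) (hB.mono (by intro _; simp only [List.mem_cons, List.mem_append, List.not_mem_nil]; tauto))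
      (by simp only [tot_cons, tot_append, tot_nil, wt_blue hyr] at *; omega) h
    exact this.perm (by intro _; simp only [cnt_cons, List.count_append, List.count_nil]; omega)


lemma T1 (hPQ : PQ red n) {e : ℝ} {y z : Pt} {U : List Pt}
    (hG : Good (x :: U)) (hlen : U.length ≤ n) (hx : red x)
    (hy : y ∈ U) (hyU : ∀ t ∈ U, t ≠ y → 0 < D e x y t)
    (hz : z ∈ U) (hzU : ∀ t ∈ U, t ≠ z → 0 < D e x t z)
    (hyz : ¬ red y ∨ ¬ red z) (hB : B2 red k U) (ht : tot red k U = 0) :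
    TrAt red x 1 U (K red k) := by
  wlog hyb : ¬ red y generalizing e y z
  · refine this (e := -e) hz (fun t h1 h2 => ?_) hy (fun t h1 h2 => ?_) hyz.symm (by tauto)
    · rw [D_neg']; exact hzU t h1 h2
    · rw [D_neg']; exact hyU t h1 h2
  have hp := List.perm_cons_erase hy
  generalize U.erase y = V at hp
  have cp := cnt_of_perm hp
  have hl := hp.length_eq
  have hG' : Good (x :: y :: V) := hG.sub (fun b => by
    have := cp b
    simp only [cnt_cons] at *; omega)
  have hn := hG'.1
  simp only [List.nodup_cons, List.mem_cons] at hn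
  refine (GvB hPQ (e := e) (y := y) (l := V) hG' (by simp at hl; omega) hx hyb ?_
    (hB.mono (fun t h => hp.mem_iff.2 h)) (by rw [← tot_perm hp]; exact ht)).perm (fun b => (cp b).symm)
  intro t h
  exact hyU t (hp.mem_iff.2 (by simp [h])) (by rintro rfl; exact hn.2.1 h)

lemma CA (hPQ : PQ red n) (hPT : PT red n) {e : ℝ} (he : e ≠ 0) {a b y z : Pt} {U : List Pt}
    (hG : Good (a :: b :: x :: U))
    (hlen : U.length + 2 ≤ n) (hx : red x) (ha : ¬ red a) (hb : ¬ red b) (hka : k a = 1) (hkb : k b = 1)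
    (hy : y ∈ U) (hyU : ∀ t ∈ U, t ≠ y → 0 < D e x y t)
    (hz : z ∈ U) (hzU : ∀ t ∈ U, t ≠ z → 0 < D e x t z)
    (hyz : ¬ red y ∨ ¬ red z)
    (hzb : 0 < D e x z b) (hE : Exm (b :: x :: U) a)
    (hB : B2 red k U) (ht : tot red k U = 0) :
    TrAt red x 3 (a :: b :: U) (K red k) := by
  have hn := hG.1
  simp only [List.nodup_cons, List.mem_cons] at hn
  push Not at hn
  obtain ⟨⟨hab, hax, haU⟩, ⟨hbx, hbU⟩, hxU, -⟩ := hn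
  have t1 := T1 hPQ (hG.sub (by intro _; simp only [cnt_cons, List.count_append, List.count_nil]; omega)) (by omega) hx hy hyU hz hzU hyz hB ht
  have ka : 1 ≤ K red k a := by rw [K_blue ha]; omega
  have kb : 1 ≤ K red k b := by rw [K_blue hb]; omega
  have hPz : ∀ t ∈ U, D e x z t ≤ 0 := by
    intro t h
    by_cases h2 : t = z
    · rw [h2, D_self]
    · have := hzU t h h2; rw [D_swap]; linarith
  have hPy : ∀ t ∈ U, D (-e) x y t ≤ 0 := by
    intro t h
    by_cases h2 : t = y
    · rw [h2, D_self]
    · have := hyU t h h2; rw [D_neg]; linarith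
  have hxy : x ≠ y := by rintro rfl; exact hxU hy
  have hxz : x ≠ z := by rintro rfl; exact hxU hz
  have hya : y ≠ a := by rintro rfl; exact haU hy
  have hza : z ≠ a := by rintro rfl; exact haU hz
  rcases hG.2.lt_or he (p := x) (q := y) (r := a) (by simp) (by simp [hy]) (by simp) hxy (Ne.symm hax) hya with h1 | h1
  · rcases hG.2.lt_or he (p := x) (q := z) (r := a) (by simp) (by simp [hz]) (by simp) hxz (Ne.symm hax) hza with h2 | h2
    · exact twoLeaf (-e*(z.2-x.2)) (e*(z.1-x.1)) (-e*(z.2-x.2)) (e*(z.1-x.1)) t1 (opp hx ha) ka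
        (opp hx hb) kb (hG.sub (by intro _; simp only [cnt_cons, List.count_append, List.count_nil]; omega)) (fun t h => by rw [D_F]; exact hPz t h) (by rw [D_F]; exact h2)
        (fun t h => by rw [D_F]; exact hPz t h) (by rw [D_F]; exact hzb)
    · have t2 := AU hPQ hPT he (hG.sub (by intro _; simp only [cnt_cons, List.count_append, List.count_nil]; omega)) (by omega) hx ha hka hy hyU hz hzU hyz h1 h2 (hE.mono (by intro _; simp only [List.mem_cons, List.mem_append, List.not_mem_nil]; tauto)) hB ht (by omega)
      have t3 := leafD_pos e z t2 (opp hx hb) kb (hG.sub (by intro _; simp only [cnt_cons, List.count_append, List.count_nil]; omega)) (by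
        intro t h
        rcases List.mem_cons.1 h with rfl | h
        · rw [D_swap]; linarith
        · exact hPz t h) hzb
      exact t3.perm (by intro _; simp only [cnt_cons, List.count_append, List.count_nil]; omega)
  · exact twoLeaf (-(-e)*(y.2-x.2)) ((-e)*(y.1-x.1)) (-e*(z.2-x.2)) (e*(z.1-x.1)) t1 (opp hx ha) ka
        (opp hx hb) kb (hG.sub (by intro _; simp only [cnt_cons, List.count_append, List.count_nil]; omega)) (fun t h => by rw [D_F]; exact hPy t h) (by rw [D_F, D_neg']; exact h1)
        (fun t h => by rw [D_F]; exact hPz t h) (by rw [D_F]; exact hzb)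


lemma TNc (hPT : PT red n) {e : ℝ} {d z o : Pt} {N : List Pt}
    (hG : Good (d :: x :: z :: (N ++ [o]))) (hlen : N.length + 3 ≤ n) (hx : red x)
    (hd : ¬ red d) (hkd : k d = 1) (hz : ¬ red z) (ho : red o) (hE : Exm (x :: z :: (N ++ [o])) d)
    (f5 : ∀ t ∈ N ++ [o], 0 < D e x z t) (f6 : ∀ t ∈ N, 0 < D e x t o)
    (hzd : 0 < D e x z d) (hod : 0 < D e x o d)
    (hB : B2 red k (z :: (N ++ [o]))) (ht : tot red k (z :: (N ++ [o])) = 0) :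
    TrAt red x 1 (z :: d :: (N ++ [o])) (K red k) := by
  have hn := hG.1
  have hxz : x ≠ z := by rintro rfl; simp at hn
  have hkz := hB z (by simp) hz
  rw [tot_cons, wt_blue hz] at ht
  have s : ∀ t ∈ d :: (N ++ [o]), 0 < D e x z t := by
    intro t h
    rcases List.mem_cons.1 h with rfl | h
    · exact hzd
    · exact f5 t h
  have t1 := hPT k (N ++ [o]) d z (k z - 1) (hG.sub (by intro _; simp only [cnt_cons, List.count_append, List.count_nil]; omega)) (by simp only [List.length_cons, List.length_append, List.length_nil] at *; omega) hd hz hkd (by omega) (hE.mono (by intro _; simp only [List.mem_cons, List.mem_append, List.not_mem_nil]; tauto))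
    ((ext_line s hxz).mono (by intro _; simp only [List.mem_cons, List.mem_append, List.not_mem_nil]; tauto)) ⟨o, by simp, ho, Or.inl (sees_beyond (e := -e) (x := x) (by
      intro t h1 h2
      rw [D_neg']
      exact f6 t (by simpa [h2] using h1)) (by rw [D_neg]; linarith))⟩ (hB.mono (by intro _; simp only [List.mem_cons, List.mem_append, List.not_mem_nil]; tauto)) (by omega)
  exact hang t1 (hG.sub (by intro _; simp only [cnt_cons, List.count_append, List.count_nil]; omega)) (opp' hx hz) (by rw [K_blue hz]; omega) s

set_option maxHeartbeats 800000 in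
lemma CBz (hPQ : PQ red n) (hPT : PT red n) {e : ℝ} (he : e ≠ 0) {a b o1 y z o : Pt} {A N : List Pt}
    (hs : Srt e x (o1 :: (A ++ y :: z :: (N ++ [o]))))
    (hG : Good (a :: b :: x :: (o1 :: (A ++ y :: z :: (N ++ [o])))))
    (hlen : A.length + N.length + 6 ≤ n) (hx : red x) (ha : ¬ red a) (hb : ¬ red b) (hka : k a = 1)
    (hkb : k b = 1) (ho1 : red o1) (hy : ¬ red y) (hz : ¬ red z) (ho : red o)
    (hsb : ∀ t ∈ o1 :: (A ++ y :: z :: (N ++ [o])), 0 < D e x t b)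
    (hEa : Exm (b :: x :: (o1 :: (A ++ y :: z :: (N ++ [o])))) a)
    (hEb : Exm (a :: x :: (o1 :: (A ++ y :: z :: (N ++ [o])))) b)
    (hB : B2 red k (o1 :: (A ++ y :: z :: (N ++ [o]))))
    (htL : tot red k (y :: o1 :: A) = 0) (htN : tot red k (z :: (N ++ [o])) = 0) :
    TrAt red x 3 (a :: b :: (o1 :: (A ++ y :: z :: (N ++ [o])))) (K red k) := by
  have hn := hG.1
  have hs1 : Srt e x ([] ++ o1 :: (A ++ y :: z :: (N ++ [o]))) := by simpa using hs
  have hs2 : Srt e x ((o1 :: A) ++ y :: (z :: (N ++ [o]))) := by simpa using hs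
  have hs3 : Srt e x ((o1 :: (A ++ [y])) ++ z :: (N ++ [o])) := by simpa using hs
  have hs4 : Srt e x ((o1 :: (A ++ y :: z :: N)) ++ o :: []) := by simpa using hs
  have f1 := (srt_mid hs1).2.1
  obtain ⟨f2, f3, -⟩ := srt_mid hs2
  obtain ⟨f4, f5, -⟩ := srt_mid hs3
  have f6 := (srt_mid hs4).1
  clear hs1 hs2 hs3 hs4
  have ka : 1 ≤ K red k a := by rw [K_blue ha]; omega
  have kb : 1 ≤ K red k b := by rw [K_blue hb]; omega
  have lo : ∀ t ∈ b :: (o1 :: (A ++ y :: z :: (N ++ [o]))), 0 < D e x t a ∨ 0 < D e x a t := by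
    intro t h
    simp only [List.nodup_cons] at hn
    refine hG.2.lt_or he (by simp) (List.mem_cons_of_mem _ ?_) (by simp) ?_ ?_ ?_
    · simp only [List.mem_cons, List.mem_append] at h ⊢; tauto
    · rintro rfl
      simp only [List.mem_cons, List.mem_append] at h hn; tauto
    · rintro rfl
      simp only [List.mem_cons, List.mem_append] at hn; tauto
    · rintro rfl
      simp only [List.mem_cons, List.mem_append] at h hn; tauto
  clear hn
  have TL : TrAt red x 1 (y :: o1 :: A) (K red k) :=
    GvB' hPQ (e := e) (hG.sub (by intro _; simp only [cnt_cons, List.count_append, List.count_nil]; omega)) (by simp only [List.length_cons, List.length_append, List.length_nil] at *; omega) hx hy f2 (hB.mono (by intro _; simp only [List.mem_cons, List.mem_append, List.not_mem_nil]; tauto)) htL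
  have TN : TrAt red x 1 (z :: (N ++ [o])) (K red k) :=
    GvB hPQ (e := e) (hG.sub (by intro _; simp only [cnt_cons, List.count_append, List.count_nil]; omega)) (by simp only [List.length_cons, List.length_append, List.length_nil] at *; omega) hx hz f5 (hB.mono (by intro _; simp only [List.mem_cons, List.mem_append, List.not_mem_nil]; tauto)) htN
  have TNb : TrAt red x 1 (z :: b :: (N ++ [o])) (K red k) :=
    TNc hPT (e := e) (hG.sub (by intro _; simp only [cnt_cons, List.count_append, List.count_nil]; omega)) (by omega) hx hb hkb hz ho (hEb.mono (by intro _; simp only [List.mem_cons, List.mem_append, List.not_mem_nil]; tauto)) f5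
      (fun t h => f6 t (by simp [h])) (hsb z (by simp)) (hsb o (by simp)) (hB.mono (by intro _; simp only [List.mem_cons, List.mem_append, List.not_mem_nil]; tauto)) htN
  have pL : ∀ t ∈ y :: o1 :: A, 0 < D (-e) x z t := by
    intro t h
    rw [D_neg']
    exact f4 t (by simp only [List.mem_cons, List.mem_append, List.not_mem_nil] at h ⊢; tauto)
  have pN : ∀ t ∈ z :: b :: (N ++ [o]), D (-e) x z t ≤ 0 := by
    intro t h
    rw [D_neg]
    rcases List.mem_cons.1 h with rfl | h
    · rw [D_self]; simp
    rcases List.mem_cons.1 h with rfl | h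
    · have := hsb z (by simp); linarith
    · have := f5 t h; linarith
  -- the special point is outside the cone
  have out : (0 < D e x a o1 ∨ 0 < D e x b a) →
      TrAt red x 3 (a :: b :: (o1 :: (A ++ y :: z :: (N ++ [o])))) (K red k) := by
    intro hc
    have t1 := glueD (-e) z TNb TL (hG.sub (by intro _; simp only [cnt_cons, List.count_append, List.count_nil]; omega)) pN pL
    rcases hc with hc | hc
    · have t2 := leafD_pos (-e) o1 t1 (opp hx ha) ka (hG.sub (by intro _; simp only [cnt_cons, List.count_append, List.count_nil]; omega)) (by
        intro t h
        by_cases h1 : t = o1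
        · rw [h1, D_self]
        rw [D_neg]
        by_cases h2 : t = b
        · rw [h2]; have := hsb o1 (by simp); linarith
        have := f1 t (by simp only [List.mem_cons, List.mem_append, List.not_mem_nil] at h ⊢; tauto)
        linarith) (by rw [D_neg']; exact hc)
      exact t2.perm (by intro _; simp only [cnt_cons, List.count_append, List.count_nil]; omega)
    · have t2 := leafD_pos e b t1 (opp hx ha) ka (hG.sub (by intro _; simp only [cnt_cons, List.count_append, List.count_nil]; omega)) (by
        intro t h
        by_cases h2 : t = b
        · rw [h2, D_self]
        have := hsb t (by simp only [List.mem_cons, List.mem_append, List.not_mem_nil] at h ⊢; tauto)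
        rw [D_swap]; linarith) hc
      exact t2.perm (by intro _; simp only [cnt_cons, List.count_append, List.count_nil]; omega)
  -- attaching `b` at the end
  have fin : ∀ W : List Pt, (∀ t, (o1 :: (A ++ y :: z :: (N ++ [o])) ++ [a]).count t = W.count t) →
      0 < D e x a b → TrAt red x 2 W (K red k) →
      TrAt red x 3 (a :: b :: (o1 :: (A ++ y :: z :: (N ++ [o])))) (K red k) := by
    intro W hW hab t1
    have hm := (perm_of_cnt hW).mem_iff (a := a)
    have t2 := leafD_neg (-e) b t1 (opp hx hb) kb (hG.sub (fun t => by
      have := hW t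
      simp only [cnt_cons, List.count_append, List.count_nil] at this ⊢; omega)) (by
      intro t h
      have h := (perm_of_cnt hW).mem_iff.2 h
      rw [D_neg']
      rcases List.mem_append.1 h with h | h
      · exact hsb t h
      · rw [List.mem_singleton.1 h]; exact hab) (by rw [D_self])
    exact t2.perm (fun t => by
      have := hW t
      simp only [cnt_cons, List.count_append, List.count_nil] at this ⊢; omega)
  rcases lo o1 (by simp) with h1 | h1
  swap
  · exact out (Or.inl h1)
  rcases lo b (by simp) with h2 | h2
  · exact out (Or.inr h2)
  clear out
  rcases lo y (by simp) with h3 | h3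
  · rcases lo z (by simp) with h4 | h4
    · have t1 : TrAt red x 1 (a :: z :: (N ++ [o])) (K red k) := by
        rcases lo o (by simp) with h5 | h5
        · exact (TNc hPT (e := e) (hG.sub (by intro _; simp only [cnt_cons, List.count_append, List.count_nil]; omega)) (by omega) hx ha hka hz ho (hEa.mono (by intro _; simp only [List.mem_cons, List.mem_append, List.not_mem_nil]; tauto)) f5
            (fun t h => f6 t (by simp [h])) h4 h5 (hB.mono (by intro _; simp only [List.mem_cons, List.mem_append, List.not_mem_nil]; tauto)) htN).perm (by intro _; simp only [cnt_cons, List.count_append, List.count_nil]; omega)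
        · refine lemE hPT (e := e) (y := z) (z := o) (hG.sub (by intro _; simp only [cnt_cons, List.count_append, List.count_nil]; omega)) (by simp only [List.length_cons, List.length_append, List.length_nil] at *; omega) hx ha hka (by simp) hz ?_ (by simp) ho ?_
            h4 h5 (hEa.mono (by intro _; simp only [List.mem_cons, List.mem_append, List.not_mem_nil]; tauto)) (hB.mono (by intro _; simp only [List.mem_cons, List.mem_append, List.not_mem_nil]; tauto)) htN
          · intro t h h'
            exact f5 t (by simpa [h'] using h)
          · intro t h h'
            exact f6 t (by
              simp only [List.mem_cons, List.mem_append, List.not_mem_nil] at h ⊢; tauto)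
      have t2 := glueD (-e) z t1 TL (hG.sub (by intro _; simp only [cnt_cons, List.count_append, List.count_nil]; omega)) (by
        intro t h
        rcases List.mem_cons.1 h with rfl | h
        · rw [D_neg]; linarith
        · exact pN t (by simp only [List.mem_cons, List.mem_append, List.not_mem_nil] at h ⊢; tauto)) pL
      exact fin _ (by intro _; simp only [cnt_cons, List.count_append, List.count_nil]; omega) h2 t2
    · have t1 := leafD_pos e y TL (opp hx ha) ka (hG.sub (by intro _; simp only [cnt_cons, List.count_append, List.count_nil]; omega)) (by
        intro t h
        rcases List.mem_cons.1 h with rfl | h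
        · rw [D_self]
        · have := f2 t h; rw [D_swap]; linarith) h3
      have t2 := glueD (-e) z TNb t1 (hG.sub (by intro _; simp only [cnt_cons, List.count_append, List.count_nil]; omega)) pN (by
        intro t h
        rcases List.mem_cons.1 h with rfl | h
        · rw [D_neg']; exact h4
        · exact pL t h)
      exact t2.perm (by intro _; simp only [cnt_cons, List.count_append, List.count_nil]; omega)
  · have t1 : TrAt red x 1 (a :: y :: o1 :: A) (K red k) := by
      refine lemE hPT (e := -e) (y := y) (z := o1) (hG.sub (by intro _; simp only [cnt_cons, List.count_append, List.count_nil]; omega)) (by simp only [List.length_cons, List.length_append, List.length_nil] at *; omega) hx ha hka (by simp) hy ?_ (by simp) ho1 ?_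
            ?_ ?_ (hEa.mono (by intro _; simp only [List.mem_cons, List.mem_append, List.not_mem_nil]; tauto)) (hB.mono (by intro _; simp only [List.mem_cons, List.mem_append, List.not_mem_nil]; tauto)) htL
      · intro t h h'
        rw [D_neg']
        exact f2 t (by simpa [h'] using h)
      · intro t h h'
        rw [D_neg']
        exact f1 t (by
              simp only [List.mem_cons, List.mem_append, List.not_mem_nil] at h ⊢; tauto)
      · rw [D_neg']; exact h3
      · rw [D_neg']; exact h1
    have t2 := glueD e y t1 TN (hG.sub (by intro _; simp only [cnt_cons, List.count_append, List.count_nil]; omega)) (by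
      intro t h
      rcases List.mem_cons.1 h with rfl | h
      · rw [D_swap]; linarith
      rcases List.mem_cons.1 h with rfl | h
      · rw [D_self]
      · have := f2 t h; rw [D_swap]; linarith) f3
    exact fin _ (by intro _; simp only [cnt_cons, List.count_append, List.count_nil]; omega) h2 t2

set_option maxHeartbeats 800000 in
lemma CBj (hPQ : PQ red n) (hPT : PT red n) {e : ℝ} (he : e ≠ 0) {a b z o : Pt} {L N : List Pt}
    (hs : Srt e x (L ++ z :: (N ++ [o])))
    (hG : Good (a :: b :: x :: (L ++ z :: (N ++ [o]))))
    (hlen : L.length + N.length + 4 ≤ n) (hx : red x) (ha : ¬ red a) (hb : ¬ red b) (hka : k a = 1)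
    (hkb : k b = 1) (hz : ¬ red z) (ho : red o)
    (hsb : ∀ t ∈ L ++ z :: (N ++ [o]), 0 < D e x t b)
    (hEa : Exm (b :: x :: (L ++ z :: (N ++ [o]))) a)
    (hEb : Exm (a :: x :: (L ++ z :: (N ++ [o]))) b)
    (hB : B2 red k (L ++ z :: (N ++ [o]))) {α β : ℕ} (hα : 1 ≤ α) (hβ : 1 ≤ β) (hαβ : α + β + 1 = k z)
    (htL : tot red k L = α) (htN : tot red k (N ++ [o]) = β) :
    TrAt red x 3 (a :: b :: (L ++ z :: (N ++ [o]))) (K red k) := by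
  have hn := hG.1
  simp only [List.nodup_cons, List.mem_cons, List.mem_append, List.nodup_append] at hn
  have hLne : 1 ≤ L.length := by
    rcases L with _ | ⟨_, _⟩
    · rw [tot_nil] at htL; omega
    · simp
  have hxz : x ≠ z := by rintro rfl; tauto
  have haz : a ≠ z := by rintro rfl; tauto
  have hax : a ≠ x := by rintro rfl; tauto
  have hzL : z ∉ L := by
    intro h
    exact hn.2.2.2.2.2 z h z (Or.inl rfl) rfl
  have hzN : z ∉ N ++ [o] := by
    intro h
    simp only [List.mem_cons, List.mem_append] at h
    tauto
  clear hn
  obtain ⟨f4, f5, -⟩ := srt_mid hs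
  have hs4 : Srt e x ((L ++ z :: N) ++ o :: []) := by simpa using hs
  have f6 := (srt_mid hs4).1
  have upd : ∀ (γ : ℕ) (k' : Pt → ℕ), k' = Function.update k z γ → k' z = γ ∧ (∀ t, t ≠ z → k' t = k t) := by
    rintro γ k' rfl
    exact ⟨by simp, fun t h => by simp [h]⟩
  have ne_of : ∀ {l : List Pt}, z ∉ l → ∀ t ∈ l, t ≠ z := by
    rintro l h t h1 rfl; exact h h1
  rcases hG.2.lt_or he (p := x) (q := z) (r := a) (by simp) (by simp) (by simp) hxz (Ne.symm hax) (Ne.symm haz) with h1 | h1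
  · obtain ⟨k', hk'⟩ : ∃ k', k' = Function.update k z (β + 1) := ⟨_, rfl⟩
    obtain ⟨e1, e2⟩ := upd _ _ hk'
    clear upd hk'
    have t1 := hPQ k L z α (hG.sub (by intro _; simp only [cnt_cons, List.count_append, List.count_nil]; omega)) (by omega) hz ((ext_line' f4 hxz).mono (by intro _; simp only [List.mem_cons, List.mem_append, List.not_mem_nil]; tauto)) hα (hB.mono (by intro _; simp only [List.mem_cons, List.mem_append, List.not_mem_nil]; tauto)) htL
    have t2 := hPT k' (x :: z :: (N ++ [o])) a b 1 (hG.sub (by intro _; simp only [cnt_cons, List.count_append, List.count_nil]; omega)) (by simp only [List.length_cons, List.length_append, List.length_nil] at *; omega) ha hb (by rw [e2 a haz, hka]) le_rfl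
      (hEa.mono (by intro _; simp only [List.mem_cons, List.mem_append, List.not_mem_nil]; tauto)) (hEb.mono (by intro _; simp only [List.mem_cons, List.mem_append, List.not_mem_nil]; tauto)) ⟨x, by simp, hx, Or.inr (sees_side (e := e) (by
        intro t h h'
        rw [D_cyc]
        exact hsb t (by simp only [List.mem_cons, List.mem_append, List.not_mem_nil] at h ⊢; tauto)))⟩ (by
      intro t h h'
      by_cases h2 : t = z
      · rw [h2, e1]; omega
      rw [e2 t h2]
      refine hB t ?_ h'
      have : t ≠ x := by rintro rfl; exact h' hx
      simp only [List.mem_cons, List.mem_append, List.not_mem_nil] at h ⊢; tauto)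
      (by
        rw [tot_cons, tot_cons, wt_red hx, wt_blue hz, e1, tot_congr (k' := k) (fun t h => e2 t (ne_of hzN t h)), htN]
        push_cast; ring)
    have t3 : TrAt red z (β + 1) (b :: a :: x :: (N ++ [o])) (K red k) :=
      t2.swap (c' := K red k) (by rw [K_blue hb]; omega) (by intro _; simp only [cnt_cons, List.count_append, List.count_nil]; omega) (by simp) (by rw [K_blue hz, e1]) (by
        intro t h h'
        refine (K_congr (e2 t ?_)).le
        rintro rfl
        have := hG.1
        rw [List.nodup_iff_count_le_one] at this
        have h5 := this t
        simp only [List.mem_cons] at h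
        rcases h with h | h | h | h
        · exact h' h
        · exact haz h.symm
        · exact hxz h.symm
        · exact hzN h)
    have t4 := glueD e x t3 t1 (hG.sub (by intro _; simp only [cnt_cons, List.count_append, List.count_nil]; omega)) (by
      intro t h
      rw [D_swap']
      rcases List.mem_cons.1 h with rfl | h
      · have := hsb z (by simp); linarith
      rcases List.mem_cons.1 h with rfl | h
      · linarith
      rcases List.mem_cons.1 h with rfl | h
      · rw [D_self']; simp
      · have := f5 t h; linarith) (by
      intro t h
      rw [D_swap', ← D_swap]; exact f4 t h)
    exact t4.swap (c' := K red k) (by rw [K_blue hz]; omega) (by intro _; simp only [cnt_cons, List.count_append, List.count_nil]; omega) (by simp) (by rw [K_red hx]) (fun _ _ _ => le_rfl)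
  · obtain ⟨k', hk'⟩ : ∃ k', k' = Function.update k z (α + 1) := ⟨_, rfl⟩
    obtain ⟨e1, e2⟩ := upd _ _ hk'
    clear upd hk'
    have t1 := hPQ k' (x :: z :: L) a 1 (hG.sub (by intro _; simp only [cnt_cons, List.count_append, List.count_nil]; omega)) (by simp only [List.length_cons, List.length_append, List.length_nil] at *; omega) ha (hEa.mono (by intro _; simp only [List.mem_cons, List.mem_append, List.not_mem_nil]; tauto)) le_rfl (by
      intro t h h'
      by_cases h2 : t = z
      · rw [h2, e1]; omega
      rw [e2 t h2]
      refine hB t ?_ h'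
      have : t ≠ x := by rintro rfl; exact h' hx
      simp only [List.mem_cons, List.mem_append, List.not_mem_nil] at h ⊢; tauto)
      (by
        rw [tot_cons, tot_cons, wt_red hx, wt_blue hz, e1, tot_congr (k' := k) (fun t h => e2 t (ne_of hzL t h)), htL]
        push_cast; ring)
    have t2 : TrAt red z (α + 1) (a :: x :: L) (K red k) :=
      t1.swap (c' := K red k) (by rw [K_blue ha]; omega) (by intro _; simp only [cnt_cons, List.count_append, List.count_nil]; omega) (by simp) (by rw [K_blue hz, e1]) (by
        intro t h h'
        refine (K_congr (e2 t ?_)).le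
        rintro rfl
        simp only [List.mem_cons] at h
        rcases h with h | h | h
        · exact h' h
        · exact hxz h.symm
        · exact hzL h)
    have s : ∀ t ∈ b :: (N ++ [o]), 0 < D e x z t := by
      intro t h
      rcases List.mem_cons.1 h with rfl | h
      · exact hsb z (by simp)
      · exact f5 t h
    have t3 := hPT k (N ++ [o]) b z β (hG.sub (by intro _; simp only [cnt_cons, List.count_append, List.count_nil]; omega)) (by simp only [List.length_cons, List.length_append, List.length_nil] at *; omega) hb hz hkb hβ (hEb.mono (by intro _; simp only [List.mem_cons, List.mem_append, List.not_mem_nil]; tauto))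
      ((ext_line s hxz).mono (by intro _; simp only [List.mem_cons, List.mem_append, List.not_mem_nil]; tauto)) ⟨o, by simp, ho, Or.inl (sees_beyond (e := -e) (x := x) (by
        intro t h1 h2
        rw [D_neg']
        have : t ∈ N := by simpa [h2] using h1
        exact f6 t (by simp [this])) (by
          have := hsb o (by simp)
          rw [D_neg]; linarith))⟩ (hB.mono (by intro _; simp only [List.mem_cons, List.mem_append, List.not_mem_nil]; tauto)) htN
    have t4 := glueD (-e) x t2 t3 (hG.sub (by intro _; simp only [cnt_cons, List.count_append, List.count_nil]; omega)) (by
      intro t h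
      rw [D_neg, D_swap', neg_neg]
      rcases List.mem_cons.1 h with rfl | h
      · rw [D_swap]; linarith
      rcases List.mem_cons.1 h with rfl | h
      · rw [D_self']
      · have := f4 t h; rw [D_swap]; linarith) (by
      intro t h
      rw [D_neg, D_swap', neg_neg]; exact s t h)
    exact t4.swap (c' := K red k) (by rw [K_blue hz]; omega) (by intro _; simp only [cnt_cons, List.count_append, List.count_nil]; omega) (by simp) (by rw [K_red hx]) (fun _ _ _ => le_rfl)

lemma CB (hPQ : PQ red n) (hPT : PT red n) {e : ℝ} (he : e ≠ 0) {a b o1 o : Pt} {V : List Pt}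
    (hs : Srt e x (o1 :: (V ++ [o])))
    (hG : Good (a :: b :: x :: (o1 :: (V ++ [o]))))
    (hlen : V.length + 4 ≤ n) (hx : red x) (ha : ¬ red a) (hb : ¬ red b) (hka : k a = 1)
    (hkb : k b = 1) (ho1 : red o1) (ho : red o)
    (hsb : ∀ t ∈ o1 :: (V ++ [o]), 0 < D e x t b)
    (hEa : Exm (b :: x :: (o1 :: (V ++ [o]))) a)
    (hEb : Exm (a :: x :: (o1 :: (V ++ [o]))) b)
    (hB : B2 red k (o1 :: (V ++ [o]))) (ht : tot red k (o1 :: (V ++ [o])) = 0) :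
    TrAt red x 3 (a :: b :: (o1 :: (V ++ [o]))) (K red k) := by
  simp only [tot_cons, tot_append, tot_nil, wt_red ho1, wt_red ho] at ht
  obtain ⟨L, z, N, rfl, hz, h1, h2, h3⟩ := first_neg (red := red) (k := k) (l := V) 1 (by omega) (by omega)
  have hkz := hB z (by simp) hz
  simp only [tot_append, tot_cons, wt_blue hz] at ht
  by_cases h0 : tot red k (o1 :: L) = 0
  · rcases h3 with rfl | ⟨A, y, rfl, h3⟩
    · simp [tot_cons, tot_nil, wt_red ho1] at h0
    have hy : ¬ red y := by
      intro hy
      simp only [tot_cons, tot_append, tot_nil, wt_red ho1, wt_red hy] at h0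
      omega
    have ee : o1 :: (A ++ [y] ++ z :: N ++ [o]) = o1 :: (A ++ y :: z :: (N ++ [o])) := by simp
    rw [ee] at hs hG hsb hEa hEb hB ⊢
    exact CBz hPQ hPT he hs hG (by simp only [List.length_cons, List.length_append, List.length_nil] at *; omega) hx ha hb hka hkb ho1 hy hz ho hsb hEa hEb hB
      (by simp only [tot_cons, tot_append, tot_nil, wt_red ho1] at *; omega)
      (by simp only [tot_cons, tot_append, tot_nil, wt_red ho1, wt_red ho, wt_blue hz] at *; omega)
  · have ee : o1 :: (L ++ z :: N ++ [o]) = (o1 :: L) ++ z :: (N ++ [o]) := by simp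
    rw [ee] at hs hG hsb hEa hEb hB ⊢
    rw [tot_cons, wt_red ho1] at h0
    obtain ⟨α, hα⟩ := Int.eq_ofNat_of_zero_le h1
    exact CBj hPQ hPT he (α := α) (β := k z - 1 - α) hs hG (by simp only [List.length_cons, List.length_append, List.length_nil] at *; omega) hx ha hb hka hkb hz ho hsb hEa hEb hB (by omega) (by omega) (by omega)
      (by rw [tot_cons, wt_red ho1]; exact hα) (by rw [tot_append, tot_cons, tot_nil, wt_red ho]; omega)


lemma Tr.perm {l l' : List Pt} (h : Tr red l c) (p : l.Perm l') : Tr red l' c := by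
  obtain ⟨E, h1, h2⟩ := h
  exact ⟨E, h1.perm p, fun v hv => h2 v (p.mem_iff.2 hv)⟩

lemma dir_ex {α β : ℝ} {p q : Pt} (hne : p ≠ q) (h : F α β q p = 0) : ∃ e : ℝ, ∀ t, D e q p t = F α β q t := by
  have h2 := ne_sq hne
  refine ⟨(-α * (p.2 - q.2) + β * (p.1 - q.1)) / F (p.1-q.1) (p.2-q.2) q p, fun t => ?_⟩
  simp only [D]
  rw [div_mul_eq_mul_div, div_eq_iff h2.ne']
  simp only [F, cr] at *
  linear_combination (-(p.2-q.2)*(t.2-q.2) - (p.1-q.1)*(t.1-q.1)) * h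

set_option maxHeartbeats 800000 in
lemma TW (hPQ : PQ red n) (hPT : PT red n) {a b x0 : Pt} {l : List Pt} (hG : Good (a :: b :: l))
    (hlen : l.length + 1 ≤ n) (ha : ¬ red a) (hb : ¬ red b) (hka : k a = 1) (hkb : k b = 1)
    (hEa : Exm (b :: l) a) (hEb : Exm (a :: l) b) (hx0 : x0 ∈ l) (hx0r : red x0) (hS : Sees l b x0)
    (hB : B2 red k l) (ht : tot red k l = 1) : Tr red (a :: b :: l) (K red k) := by
  have ka : 1 ≤ K red k a := by rw [K_blue ha]; omega
  have kb : 1 ≤ K red k b := by rw [K_blue hb]; omega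
  suffices h : ∃ x U, red x ∧ l.Perm (x :: U) ∧ TrAt red x 3 (a :: b :: U) (K red k) by
    obtain ⟨x, U, hx, hp, h⟩ := h
    refine (h.tr (c' := K red k) (by rw [K_red hx]) (fun _ _ => le_rfl)).perm (perm_of_cnt (fun t => ?_))
    have := cnt_of_perm hp t
    simp only [cnt_cons] at *; omega
  obtain ⟨l', hp, hs⟩ := sort_ex one_ne_zero (hEb.mono (l' := l) (by intro _; simp only [List.mem_cons, List.mem_append, List.not_mem_nil]; tauto)) (hG.sub (by intro _; simp only [cnt_cons, List.count_append, List.count_nil]; omega))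
  have cp := cnt_of_perm hp
  rcases l' with _ | ⟨v1, l'⟩
  · have := hp.mem_iff.1 hx0
    simp at this
  have s1 := (srt_mid (L := []) hs).2.1
  have hn := hG.1
  simp only [List.nodup_cons, List.mem_cons] at hn
  push Not at hn
  obtain ⟨⟨hab, hal⟩, hbl, -⟩ := hn
  have hv1 : v1 ∈ l := hp.mem_iff.2 (by simp)
  by_cases hv : red v1
  · have hbv : b ≠ v1 := by rintro rfl; exact hbl hv1
    have hav : a ≠ v1 := by rintro rfl; exact hal hv1
    have hGv : Good (v1 :: l') := hG.sub (fun t => by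
      have := cp t
      simp only [cnt_cons] at *; omega)
    obtain ⟨U, hp2, hs2⟩ := sort_ex one_ne_zero ((ext_line s1 hbv).mono (l' := l') (by intro _; simp only [List.mem_cons, List.mem_append, List.not_mem_nil]; tauto)) hGv
    have cp2 := cnt_of_perm hp2
    refine ⟨v1, U, hv, hp.trans (hp2.cons _), ?_⟩
    have hpp := hp.trans (hp2.cons v1)
    have hsb : ∀ t ∈ U, 0 < D 1 v1 t b := by
      intro t h
      rw [← D_cyc]
      exact s1 t (hp2.mem_iff.2 h)
    replace hG : Good (a :: b :: v1 :: U) := hG.sub (fun t => by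
      have := cnt_of_perm hpp t
      simp only [cnt_cons] at *; omega)
    replace hEa : Exm (b :: v1 :: U) a := hEa.mono (fun t h => by
      rw [List.mem_cons, hpp.mem_iff]; simpa using h)
    replace hEb : Exm (a :: v1 :: U) b := hEb.mono (fun t h => by
      rw [List.mem_cons, hpp.mem_iff]; simpa using h)
    replace hB : B2 red k U := hB.mono (fun t h => by
      rw [hpp.mem_iff]; simp [h])
    rw [tot_perm hpp, tot_cons, wt_red hv] at ht
    have hl := hpp.length_eq
    rw [List.length_cons] at hl
    clear hp hp2 hpp cp cp2 hs s1 hS hx0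
    rcases U with _ | ⟨h, U⟩
    · refine (twoLeaf (m := 0) _ _ _ _ TrAt_nil (opp hv ha) ka (opp hv hb) kb ?_ (by simp) (ne_sq hav) (by simp) (ne_sq hbv)).mono
        (by omega) (fun _ _ => le_rfl)
      exact hG.sub (by intro _; simp only [cnt_cons, List.count_append, List.count_nil]; omega)
    rcases List.eq_nil_or_concat U with rfl | ⟨V, o, rfl⟩
    · exfalso
      rw [tot_cons, tot_nil] at ht
      by_cases hr : red h
      · rw [wt_red hr] at ht; omega
      · rw [wt_blue hr] at ht
        have := hB h (by simp) hr
        omega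
    rw [List.concat_eq_append] at *
    by_cases hc : red h ∧ red o
    · exact CB hPQ hPT one_ne_zero hs2 hG (by simp only [List.length_cons, List.length_append, List.length_nil] at *; omega) hv ha hb hka hkb hc.1 hc.2 hsb hEa hEb hB (by omega)
    · have q1 := (srt_mid (L := []) hs2).2.1
      have q2 := (srt_mid (L := h :: V) hs2).1
      refine CA hPQ hPT one_ne_zero (y := h) (z := o) hG (by simp only [List.length_cons, List.length_append, List.length_nil] at *; omega) hv ha hb hka hkb (by simp) ?_ (by simp) ?_ (by tauto)
        (hsb o (by simp)) hEa hB (by omega)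
      · intro t h1 h2
        exact q1 t (by simpa [h2] using h1)
      · intro t h1 h2
        exact q2 t (by simpa [h2] using h1)
  · obtain ⟨α1, β1, hS1, hS2⟩ := hS
    obtain ⟨α, β, p, q, hpl, hpb, hq, hqr, hpos, hpq, hmin⟩ := ivt (red := red) (o := b) (v1 := v1) (q1 := x0)
      (α0 := -1*(v1.2-b.2)) (β0 := 1*(v1.1-b.1)) (α1 := α1) (β1 := β1)
      (U := l) (fun p hp q hq r hr => hG.2 p (by simp [hp]) q (by simp [hq]) r (by simp [hr]))
      hv1 hv (by rw [D_F, D_self]) (fun t h1 h2 => by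
        rw [D_F]
        have := hp.mem_iff.1 h1
        exact s1 t (by simpa [h2] using this)) hx0 hx0r
      (by
        have : F α1 β1 b x0 = - F α1 β1 x0 b := by simp only [F]; ring
        rw [this]; linarith)
      (fun t h1 h2 => by
        have := hS1 t h1 h2
        rw [← F_sub α1 β1 b] at this; linarith)
    have hpqne : p ≠ q := by rintro rfl; exact hpb hqr
    have hF0 : F α β q p = 0 := by rw [← F_sub α β b]; linarith
    obtain ⟨d, hd⟩ := dir_ex hpqne hF0
    have hFb : F α β q b < 0 := by
      have : F α β q b = - F α β b q := by simp only [F]; ring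
      rw [this]; linarith
    have hd0 : d ≠ 0 := by
      rintro rfl
      have := hd b
      simp only [D, zero_mul] at this
      linarith
    have hpr := List.perm_cons_erase hq
    generalize l.erase q = U0 at hpr
    have hGq : Good (q :: U0) := hG.sub (fun t => by
      have := cnt_of_perm hpr t
      simp only [cnt_cons] at *; omega)
    have hnq := hGq.1
    simp only [List.nodup_cons] at hnq
    have side : ∀ t ∈ U0, t ≠ p → 0 < D d q p t := by
      intro t h1 h2
      rw [hd, ← F_sub α β b]
      have := hmin t (hpr.mem_iff.2 (by simp [h1])) h2 (by rintro rfl; exact hnq.1 h1)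
      linarith
    obtain ⟨U, hp2, hs2⟩ := sort_ex (e := -d) (by simpa using hd0)
      (ext_side (e := d) (q := p) (fun t h1 _ h2 => side t h1 h2) hpqne) hGq
    have hpp := hpr.trans (hp2.cons q)
    refine ⟨q, U, hqr, hpp, ?_⟩
    have hpU : p ∈ U := by
      have := hpp.mem_iff.1 hpl
      simpa [hpqne] using this
    replace hG : Good (a :: b :: q :: U) := hG.sub (fun t => by
      have := cnt_of_perm hpp t
      simp only [cnt_cons] at *; omega)
    replace hEa : Exm (b :: q :: U) a := hEa.mono (fun t h => by
      rw [List.mem_cons, hpp.mem_iff]; simpa using h)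
    replace hB : B2 red k U := hB.mono (fun t h => by
      rw [hpp.mem_iff]; simp [h])
    rw [tot_perm hpp, tot_cons, wt_red hqr] at ht
    have hl := hpp.length_eq
    rw [List.length_cons] at hl
    replace side : ∀ t ∈ U, t ≠ p → 0 < D (-d) q t p := fun t h1 h2 => by
      rw [D_neg']; exact side t (hp2.mem_iff.2 h1) h2
    have hbd : 0 < D (-d) q p b := by rw [D_neg, hd]; linarith
    clear hp hp2 hpp cp hs s1 hS1 hS2 hx0 hpr hnq hGq hmin
    rcases U with _ | ⟨y, U⟩
    · simp at hpU
    have q1 := (srt_mid (L := []) hs2).2.1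
    exact CA hPQ hPT (e := -d) (by simpa using hd0) (y := y) (z := p) hG (by simp only [List.length_cons, List.length_append, List.length_nil] at *; omega) hqr ha hb hka hkb (by simp)
      (fun t h1 h2 => q1 t (by simpa [h2] using h1)) hpU side (Or.inr hpb) hbd hEa hB (by omega)

lemma PT_succ (hPQ : PQ red n) (hPT : PT red n) : PT red (n+1) := by
  intro k l a p kp hG hlen ha hp hka hkp hEa hEp hS hB ht
  have hn := hG.1
  simp only [List.nodup_cons, List.mem_cons] at hn
  push Not at hn
  obtain ⟨⟨hap, hal⟩, hpl, -⟩ := hn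
  obtain ⟨k', hk'⟩ : ∃ k', k' = Function.update k p kp := ⟨_, rfl⟩
  have e1 : k' p = kp := by simp [hk']
  have e2 : ∀ t, t ≠ p → k' t = k t := fun t h => by simp [hk', h]
  clear hk'
  have hlp : ∀ t ∈ l, t ≠ p := by rintro t h rfl; exact hpl h
  have hB' : B2 red k' l := fun t h1 h2 => by rw [e2 t (hlp t h1)]; exact hB t h1 h2
  have ht' : tot red k' l = kp := by rw [tot_congr (k' := k) (fun t h => e2 t (hlp t h))]; exact ht
  have hka' : k' a = 1 := by rw [e2 a hap]; exact hka
  suffices h : Tr red (a :: p :: l) (K red k') by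
    refine h.at (by intro _; simp only [cnt_cons, List.count_append, List.count_nil]; omega) (by rw [K_blue hp, e1]) ?_
    intro t h
    refine (K_congr (e2 t ?_)).le
    rcases List.mem_cons.1 h with rfl | h
    · exact hap
    · exact hlp t h
  by_cases h2 : 2 ≤ kp
  · have := PQ_succ hPQ hPT k' (p :: l) a 1 hG (by simp only [List.length_cons, List.length_append, List.length_nil] at *; omega) ha hEa le_rfl (by
      intro t h h'
      rcases List.mem_cons.1 h with rfl | h
      · omega
      · exact hB' t h h') (by rw [tot_cons, wt_blue hp]; omega)
    exact this.tr (by rw [K_blue ha]; omega) (fun _ _ => le_rfl)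
  · have hkp1 : kp = 1 := by omega
    subst hkp1
    obtain ⟨x0, hx0, hx0r, hS | hS⟩ := hS
    · have := TW hPQ hPT (a := p) (b := a) (hG.sub (by intro _; simp only [cnt_cons, List.count_append, List.count_nil]; omega)) (by omega) hp ha e1 hka' hEp hEa hx0 hx0r hS hB' ht'
      exact this.perm (perm_of_cnt (by intro _; simp only [cnt_cons, List.count_append, List.count_nil]; omega))
    · exact TW hPQ hPT hG (by omega) ha hp hka' e1 hEa hEp hx0 hx0r hS hB' ht'

theorem allP (red : Pt → Prop) (n : ℕ) : PQ red n ∧ PT red n := by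
  induction n with
  | zero =>
    constructor
    · intro k l b kb _ h; omega
    · intro k l a p kp _ h; omega
  | succ n ih => exact ⟨PQ_succ ih.1 ih.2, PT_succ ih.1 ih.2⟩


lemma GP_of_GenPos {S : Set Pt} {l : List Pt} (h : GenPos S) (hl : ∀ t ∈ l, t ∈ S) : GP l := by
  intro p hp q hq r hr h1 h2 h3 hc
  refine h p (hl p hp) q (hl q hq) r (hl r hr) h1 h2 h3 ?_
  rw [collinear_iff_of_mem (p₀ := p) (by simp)]
  refine ⟨q - p, ?_⟩
  have hsq := ne_sq h1.symm
  intro t ht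
  simp only [Set.mem_insert_iff, Set.mem_singleton_iff] at ht
  rcases ht with rfl | rfl | rfl
  · exact ⟨0, by simp⟩
  · exact ⟨1, by simp⟩
  · refine ⟨F (q.1-p.1) (q.2-p.2) p t / F (q.1-p.1) (q.2-p.2) p q, ?_⟩
    simp only [cr] at hc
    ext
    · simp only [vadd_eq_add, Prod.fst_add, Prod.smul_fst, Prod.fst_sub, smul_eq_mul]
      rw [← sub_eq_iff_eq_add, div_mul_eq_mul_div, eq_div_iff hsq.ne']
      simp only [F]
      linear_combination (-(q.2-p.2)) * hc
    · simp only [vadd_eq_add, Prod.snd_add, Prod.smul_snd, Prod.snd_sub, smul_eq_mul]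
      rw [← sub_eq_iff_eq_add, div_mul_eq_mul_div, eq_div_iff hsq.ne']
      simp only [F]
      linear_combination ((q.1-p.1)) * hc

lemma to_graph {R B : Finset Pt} {E : Finset (Pt × Pt)} (hE : PTree red (R ∪ B).toList E)
    (hcol : ∀ u ∈ R ∪ B, ∀ v ∈ R ∪ B, red u → ¬ red v → (u ∈ R ∧ v ∈ B) ∨ (u ∈ B ∧ v ∈ R)) :
    ∃ G : SimpleGraph {x : Pt // x ∈ R ∪ B}, PlaneBichromTree R B G ∧ ∀ v, deg G v ≤ dg E v.1 := by
  have hmem : ∀ e ∈ E, e.1 ∈ R ∪ B ∧ e.2 ∈ R ∪ B ∧ red e.1 ∧ ¬ red e.2 := by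
    intro e he
    have := hE.mem e he
    simpa only [Finset.mem_toList] using this
  have hajs : ∀ u v, Aj E u v → Aj E v u := fun u v h => h.symm
  have hajne : ∀ u v, Aj E u v → u ≠ v := by
    rintro u v (h | h)
    · exact hE.ne h
    · exact (hE.ne h).symm
  let G : SimpleGraph {x : Pt // x ∈ R ∪ B} :=
    { Adj := fun u v => Aj E u.1 v.1
      symm := ⟨fun u v h => hajs _ _ h⟩
      loopless := ⟨fun u h => hajne _ _ h rfl⟩ }
  have hadj : ∀ u v, G.Adj u v ↔ Aj E u.1 v.1 := fun _ _ => Iff.rfl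
  have hreach : ∀ u v : Pt, Relation.ReflTransGen (Aj E) u v → ∀ (hu : u ∈ R ∪ B) (hv : v ∈ R ∪ B),
      G.Reachable ⟨u, hu⟩ ⟨v, hv⟩ := by
    intro u v h
    induction h with
    | refl => intro _ _; exact SimpleGraph.Reachable.refl _
    | tail h1 h2 ih =>
      intro hu hv
      rename_i b d
      have hb : b ∈ R ∪ B := by
        rcases h2 with h | h
        · exact (hmem _ h).1
        · exact (hmem _ h).2.1
      exact (ih hu hb).trans (SimpleGraph.Adj.reachable ((hadj ⟨b, hb⟩ ⟨d, hv⟩).2 h2))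
  have hcard : E.card + 1 = (R ∪ B).card := by
    have := hE.card
    rwa [Finset.length_toList] at this
  have hne : Nonempty {x : Pt // x ∈ R ∪ B} := by
    have : 0 < (R ∪ B).card := by omega
    obtain ⟨u, hu⟩ := Finset.card_pos.1 this
    exact ⟨⟨u, hu⟩⟩
  have hconn : G.Connected := by
    rw [SimpleGraph.connected_iff]
    refine ⟨?_, hne⟩
    rintro ⟨u, hu⟩ ⟨v, hv⟩
    exact hreach u v (hE.conn u (by simpa using hu) v (by simpa using hv)) hu hv
  have hle : Nat.card G.edgeSet ≤ E.card := by
    have hf : Nat.card {e // e ∈ E} = E.card := by simp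
    rw [← hf]
    refine Nat.card_le_card_of_surjective (fun e : {e // e ∈ E} =>
      (⟨s(⟨e.1.1, (hmem e.1 e.2).1⟩, ⟨e.1.2, (hmem e.1 e.2).2.1⟩), (hadj _ _).2 (Or.inl e.2)⟩ : G.edgeSet)) ?_
    rintro ⟨s, hs⟩
    induction s using Sym2.ind with
    | _ u v =>
      rcases (hadj u v).1 hs with h | h
      · exact ⟨⟨_, h⟩, rfl⟩
      · exact ⟨⟨_, h⟩, Subtype.ext Sym2.eq_swap⟩
  refine ⟨G, ⟨?_, ?_, ?_⟩, ?_⟩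
  · rw [SimpleGraph.isTree_iff_connected_and_card]
    refine ⟨hconn, ?_⟩
    have h1 := hconn.card_vert_le_card_edgeSet_add_one
    have h2 : Nat.card {x : Pt // x ∈ R ∪ B} = (R ∪ B).card := by
      rw [Nat.card_eq_fintype_card, Fintype.card_coe]
    omega
  · intro u v h
    rcases (hadj u v).1 h with h | h
    · have := hmem _ h
      exact hcol _ u.2 _ v.2 this.2.2.1 this.2.2.2
    · have := hmem _ h
      have := hcol _ v.2 _ u.2 this.2.2.1 this.2.2.2
      tauto
  · intro u v x y h1 h2 hne p hp1 hp2
    have hne1 : ¬ (u.1 = x.1 ∧ v.1 = y.1) := by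
      rintro ⟨h3, h4⟩
      exact hne (by rw [Subtype.ext h3, Subtype.ext h4])
    have hne2 : ¬ (u.1 = y.1 ∧ v.1 = x.1) := by
      rintro ⟨h3, h4⟩
      exact hne (by rw [Subtype.ext h3, Subtype.ext h4, Sym2.eq_swap])
    have hs1 := segment_symm ℝ u.1 v.1
    have hs2 := segment_symm ℝ x.1 y.1
    rcases (hadj u v).1 h1 with h1 | h1 <;> rcases (hadj x y).1 h2 with h2 | h2
    · exact hE.nc _ h1 _ h2 (by rw [Ne, Prod.mk.injEq]; tauto) p hp1 hp2
    · have := hE.nc _ h1 _ h2 (by rw [Ne, Prod.mk.injEq]; tauto) p hp1 (hs2 ▸ hp2)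
      simp only at this; tauto
    · have := hE.nc _ h1 _ h2 (by rw [Ne, Prod.mk.injEq]; tauto) p (hs1 ▸ hp1) hp2
      simp only at this; tauto
    · have := hE.nc _ h1 _ h2 (by rw [Ne, Prod.mk.injEq]; tauto) p (hs1 ▸ hp1) (hs2 ▸ hp2)
      simp only at this; tauto
  · intro v
    unfold deg dg
    rw [← Set.ncard_image_of_injective _ Subtype.val_injective]
    refine le_trans ?_ (Finset.card_image_le (f := fun e : Pt × Pt => if e.1 = v.1 then e.2 else e.1))
    rw [← Set.ncard_coe_finset]
    refine Set.ncard_le_ncard ?_ (Finset.finite_toSet _)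
    rintro _ ⟨w, hw, rfl⟩
    have hw := (hadj v w).1 hw
    have hwne := hajne _ _ hw
    rw [Finset.mem_coe, Finset.mem_image]
    rcases hw with hw | hw
    · exact ⟨(v.1, w.1), by simp [hw], by simp⟩
    · exact ⟨(w.1, v.1), by simp [hw], by simp [hwne.symm]⟩

lemma distribute (B : Finset Pt) (q : ℕ) (hq : 1 ≤ q) : ∀ S : ℕ, B.card ≤ S → S ≤ B.card * q →
    ∃ f : Pt → ℕ, (∀ b ∈ B, 1 ≤ f b ∧ f b ≤ q) ∧ ∑ b ∈ B, f b = S := by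
  induction B using Finset.induction_on with
  | empty => intro S h1 h2; exact ⟨fun _ => 0, by simp, by simp at *; omega⟩
  | insert a s ha ih =>
    intro S h1 h2
    rw [Finset.card_insert_of_notMem ha] at h1 h2
    rw [add_mul, one_mul] at h2
    have hsq : s.card ≤ s.card * q := Nat.le_mul_of_pos_right _ hq
    obtain ⟨j, hj1, hj2, hj3, hj4⟩ : ∃ j, 1 ≤ j ∧ j ≤ q ∧ s.card + j ≤ S ∧ S ≤ s.card * q + j := by
      by_cases h : s.card + q ≤ S
      · exact ⟨q, hq, le_rfl, h, h2⟩
      · exact ⟨S - s.card, by omega, by omega, by omega, by omega⟩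
    obtain ⟨f, hf1, hf2⟩ := ih (S - j) (by omega) (by omega)
    refine ⟨Function.update f a j, ?_, ?_⟩
    · intro b hb
      by_cases h : b = a
      · subst h; simp [hj1, hj2]
      · rw [Function.update_of_ne h]
        exact hf1 b (by simpa [h] using hb)
    · rw [Finset.sum_insert ha, Function.update_self, Finset.sum_congr rfl (g := f), hf2]
      · omega
      · intro b hb
        rw [Function.update_of_ne]
        rintro rfl; exact ha hb

lemma tot_union {X Y : Finset Pt} (hd : Disjoint X Y) (k : Pt → ℕ) :
    tot (· ∈ X) k (X ∪ Y).toList = X.card + ∑ b ∈ Y, (1 - (k b : ℤ)) := by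
  unfold tot
  rw [Finset.sum_map_toList, Finset.sum_union hd]
  congr 1
  · rw [Finset.sum_congr rfl (g := fun _ => (1:ℤ))]
    · simp
    · intro t h; exact wt_red h
  · refine Finset.sum_congr rfl (fun t h => wt_blue ?_)
    exact fun h' => Finset.disjoint_left.1 hd h' h

lemma equal_case {X Y : Finset Pt} (hd : Disjoint X Y) (hc : X.card = Y.card)
    (hG : Good (X ∪ Y).toList) {u : Pt} (hu : u ∈ Y) (hE : Exm (X ∪ Y).toList u) :
    ∃ E, PTree (· ∈ X) (X ∪ Y).toList E ∧ ∀ v ∈ X ∪ Y, dg E v ≤ 3 := by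
  have hp := List.perm_cons_erase (show u ∈ (X ∪ Y).toList by simp [hu])
  have ht := tot_union hd (fun _ => 2)
  rw [tot_perm hp] at ht
  generalize (X ∪ Y).toList.erase u = l at hp ht
  have hur : ¬ u ∈ X := fun h => Finset.disjoint_left.1 hd h hu
  rw [tot_cons, wt_blue (red := (· ∈ X)) hur] at ht
  have h := (allP (· ∈ X) (l.length + 1)).1 (fun _ => 2) l u 1 (hG.sub (fun a => (cnt_of_perm hp a).ge))
    le_rfl hur (hE.mono (fun t h => hp.mem_iff.2 (by simp [h]))) le_rfl (fun _ _ _ => le_rfl)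
    (by
      simp only [Finset.sum_const, nsmul_eq_mul, hc] at ht
      push_cast at ht ⊢
      linarith)
  obtain ⟨E, h1, h2⟩ := (h.tr (c' := fun _ => 3) (by omega) (fun t _ => by
    simp only [K]; split_ifs <;> omega)).perm hp.symm
  exact ⟨E, h1, fun v hv => h2 v (by simpa using hv)⟩

theorem statement_0 (R B : Finset Pt) (hdisj : Disjoint R B) (hB : B.Nonempty)
    (hBR : B.card ≤ R.card) (hgp : GenPos (↑(R ∪ B) : Set Pt))
    (δ : ℤ) (hδ : δ = ⌈((R.card : ℚ) - 1) / (B.card : ℚ)⌉) :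
    ∃ G : SimpleGraph {x : Pt // x ∈ R ∪ B},
      PlaneBichromTree R B G ∧ ∀ v, (deg G v : ℤ) ≤ max 3 (δ + 1) := by
  have hGl : Good (R ∪ B).toList :=
    ⟨Finset.nodup_toList _, GP_of_GenPos hgp (fun t h => by
      have := Finset.mem_toList.1 h
      exact Finset.mem_coe.2 this)⟩
  have hBpos : 0 < B.card := Finset.card_pos.2 hB
  rcases hBR.lt_or_eq with hlt | heq
  · have hδ1 : (R.card : ℤ) - 1 ≤ B.card * δ := by
      have h1 : ((R.card : ℚ) - 1) / (B.card : ℚ) ≤ δ := by rw [hδ]; exact Int.le_ceil _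
      rw [div_le_iff₀ (by exact_mod_cast hBpos)] at h1
      have h2 : (((R.card : ℤ) - 1 : ℤ) : ℚ) ≤ ((δ * B.card : ℤ) : ℚ) := by push_cast; exact h1
      have h3 := Int.cast_le.1 h2
      rw [mul_comm]; exact h3
    obtain ⟨q, hq⟩ := Int.eq_ofNat_of_zero_le (show 0 ≤ max 2 δ by omega)
    have hq2 : 2 ≤ q := by omega
    have hqδ : δ ≤ q := by omega
    obtain ⟨f, hf1, hf2⟩ := distribute B q (by omega) (R.card - 1) (by omega) (by
      have h1 : (B.card : ℤ) * δ ≤ B.card * q := mul_le_mul_of_nonneg_left hqδ (by omega)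
      have h2 : ((R.card - 1 : ℕ) : ℤ) = (R.card : ℤ) - 1 := by omega
      have h3 : ((R.card - 1 : ℕ) : ℤ) ≤ ((B.card * q : ℕ) : ℤ) := by push_cast; omega
      exact_mod_cast h3)
    have hcol : ∀ u ∈ R ∪ B, u ∉ R → u ∈ B := by
      intro u hu h
      rcases Finset.mem_union.1 hu with h' | h'
      · exact absurd h' h
      · exact h'
    obtain ⟨E, hE1, hE2⟩ := PG_succ (allP (· ∈ R) (R ∪ B).toList.length).1 (fun b => f b + 1) (R ∪ B).toList hGl
      (by omega) (by
        intro t h h'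
        have := hf1 t (hcol t (by simpa using h) h')
        show 2 ≤ f t + 1
        omega) (by
        rw [tot_union hdisj]
        have : ∑ b ∈ B, (1 - (((f b + 1 : ℕ)) : ℤ)) = - ((∑ b ∈ B, f b : ℕ) : ℤ) := by
          push_cast
          rw [← Finset.sum_neg_distrib]
          exact Finset.sum_congr rfl (fun _ _ => by ring)
        rw [this, hf2]
        omega)
    obtain ⟨G, hG1, hG2⟩ := to_graph hE1 (fun u hu v hv h1 h2 => Or.inl ⟨h1, hcol v hv h2⟩)
    refine ⟨G, hG1, fun v => ?_⟩
    have h1 := hG2 v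
    have h2 := hE2 v.1 (by simpa using v.2)
    have h3 : K (· ∈ R) (fun b => f b + 1) v.1 ≤ q + 1 := by
      by_cases h : v.1 ∈ R
      · rw [K_red h]; omega
      · rw [K_blue h]
        have := hf1 _ (hcol _ v.2 h)
        omega
    omega
  · suffices h : ∃ G : SimpleGraph {x : Pt // x ∈ R ∪ B}, PlaneBichromTree R B G ∧ ∀ v, deg G v ≤ 3 by
      obtain ⟨G, h1, h2⟩ := h
      refine ⟨G, h1, fun v => ?_⟩
      have := h2 v
      omega
    obtain ⟨u, hu, hE⟩ := exists_ext (R ∪ B).toList (by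
      intro h
      rw [Finset.toList_eq_nil, Finset.union_eq_empty] at h
      exact hB.ne_empty h.2)
    rcases Finset.mem_union.1 (Finset.mem_toList.1 hu) with hu | hu
    · obtain ⟨E, h1, h2⟩ := equal_case hdisj.symm heq (u := u) (by rw [Finset.union_comm]; exact hGl) hu
        (by rw [Finset.union_comm]; exact hE)
      rw [Finset.union_comm] at h1 h2
      obtain ⟨G, hG1, hG2⟩ := to_graph h1 (fun u hu v hv h1 h2 => Or.inr ⟨h1, by
        rcases Finset.mem_union.1 hv with h | h
        · exact h
        · exact absurd h h2⟩)
      exact ⟨G, hG1, fun v => (hG2 v).trans (h2 v.1 v.2)⟩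
    · obtain ⟨E, h1, h2⟩ := equal_case hdisj heq.symm (u := u) hGl hu hE
      obtain ⟨G, hG1, hG2⟩ := to_graph h1 (fun u hu v hv h1 h2 => Or.inl ⟨h1, by
        rcases Finset.mem_union.1 hv with h | h
        · exact absurd h h2
        · exact h⟩)
      exact ⟨G, hG1, fun v => (hG2 v).trans (h2 v.1 v.2)⟩
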